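/- arXiv:2310.01868 — 4 statements merged into one kernel-verified Lean document; each statement's English description precedes it below -/
import Mathlib

section
/- Let d, n be integers with 1 ≤ d < n. Then for every continuous function F : 𝒞_d^n → ℝ^d there exists a point z ∈ 𝒞_d^n such that F(z) = F(−z). -/
open Finset

noncomputable section

/-- The real sign of a Boolean coordinate: `true ↦ 1`, `false ↦ -1`. -/
def sgn (b : Bool) : ℝ := if b then 1 else -1

/-- Hamming distance on the discrete cube `{-1,1}^n ≃ Bool^n`. -/
def hamming {n : ℕ} (x y : Fin n → Bool) : ℕ :=
  (Finset.univ.filter fun i => x i ≠ y i).card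

/-- Flip the `i`-th coordinate. -/
def flipc {ι : Type*} [DecidableEq ι] (x : ι → Bool) (i : ι) : ι → Bool :=
  Function.update x i (!(x i))

/-- Negate all coordinates (the antipodal map). -/
def negc {ι : Type*} (x : ι → Bool) : ι → Bool := fun i => !(x i)

/-- `X` has Rademacher type `p` with constant `T`. -/
def RademacherType (X : Type*) [NormedAddCommGroup X] [NormedSpace ℝ X] (p T : ℝ) : Prop :=
  ∀ (m : ℕ) (v : Fin m → X),
    (2 ^ m : ℝ)⁻¹ * ∑ x : Fin m → Bool, ‖∑ i, sgn (x i) • v i‖ ^ p ≤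
      T ^ p * ∑ i, ‖v i‖ ^ p

/-- `X` has cotype `q` with constant `Cq`. -/
def CotypeC (X : Type*) [NormedAddCommGroup X] [NormedSpace ℝ X] (q Cq : ℝ) : Prop :=
  ∀ (m : ℕ) (v : Fin m → X),
    (∑ i, ‖v i‖ ^ q) / Cq ^ q ≤
      (2 ^ m : ℝ)⁻¹ * ∑ x : Fin m → Bool, ‖∑ i, sgn (x i) • v i‖ ^ q

open scoped Classical in
/-- The weak `ℓ_p` norm of a finite real vector. -/
def weakLp {ι : Type*} [Fintype ι] (p : ℝ) (w : ι → ℝ) : ℝ :=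
  sSup {z | ∃ r : ℝ, 0 ≤ r ∧
    z = r * ((Finset.univ.filter fun i => r ≤ |w i|).card : ℝ) ^ (1 / p)}

/-- Metric stable type `p` with constant `S`. -/
def MetricStableType (M : Type*) [PseudoMetricSpace M] (p S : ℝ) : Prop :=
  ∀ (n : ℕ) (f : (Fin n → Bool) → M),
    (2 ^ n : ℝ)⁻¹ * ∑ x : Fin n → Bool, dist (f x) (f (negc x)) ^ p ≤
      S ^ p * ((2 ^ n : ℝ)⁻¹ *
        ∑ x : Fin n → Bool, weakLp p (fun i => (1 / 2) * dist (f x) (f (flipc x i))) ^ p)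

/-- The product biased measure weight of a point of the cube. -/
def biasedWeight {ι : Type*} [Fintype ι] (α : ι → ℝ) (x : ι → Bool) : ℝ :=
  ∏ i, if x i then α i else 1 - α i

/-- The biased discrete partial derivative `∂_i^α`. -/
def bder {ι : Type*} [DecidableEq ι] {X : Type*} [AddCommGroup X] [Module ℝ X]
    (α : ℝ) (i : ι) (f : (ι → Bool) → X) (x : ι → Bool) : X :=
  f x - (α • f (Function.update x i true) + (1 - α) • f (Function.update x i false))

/-- The `L_p(μ; X)` norm with respect to the weight `μ` on the cube. -/
def lpNormW {ι : Type*} [Fintype ι] [DecidableEq ι] {X : Type*} [NormedAddCommGroup X]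
    (μ : (ι → Bool) → ℝ) (p : ℝ) (g : (ι → Bool) → X) : ℝ :=
  (∑ x : ι → Bool, μ x * ‖g x‖ ^ p) ^ (1 / p)

/-- The Orlicz `L_p(log L)^{p/2}(μ; X)` norm with respect to the weight `μ` on the cube. -/
def orliczNormW {ι : Type*} [Fintype ι] [DecidableEq ι] {X : Type*} [NormedAddCommGroup X]
    (μ : (ι → Bool) → ℝ) (p : ℝ) (g : (ι → Bool) → X) : ℝ :=
  sInf {γ : ℝ | 0 < γ ∧
    ∑ x : ι → Bool, (μ x * (‖g x‖ ^ p / γ ^ p)) *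
      Real.log (Real.exp 1 + ‖g x‖ ^ p / γ ^ p) ^ (p / 2) ≤ 1}

/-- The one-dimensional transition kernel `p_t^α`. -/
def ptrans (t α : ℝ) : Bool → Bool → ℝ := fun a b =>
  match a, b with
  | true, true => 1 - (1 - Real.exp (-t)) * (1 - α)
  | true, false => (1 - Real.exp (-t)) * (1 - α)
  | false, true => (1 - Real.exp (-t)) * α
  | false, false => 1 - (1 - Real.exp (-t)) * α

/-- The matrix `η_t^α(·,·;θ)`. -/
def eta (t α θ : ℝ) : Bool → Bool → ℝ := fun a b =>
  match a, b with
  | true, true => (Real.exp (-t) - θ) / ptrans t α true true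
  | true, false => (-θ) / ptrans t α false true
  | false, true => (θ - Real.exp (-t)) / ptrans t α true false
  | false, false => θ / ptrans t α false false

/-- The product transition kernel `p_t^𝛂`. -/
def pprod {n : ℕ} (t : ℝ) (α : Fin n → ℝ) (x y : Fin n → Bool) : ℝ :=
  ∏ i, ptrans t (α i) (x i) (y i)

/-- Glue coordinates on `σ` (given by `x`) with coordinates off `σ` (given by `w`). -/
def glue {n : ℕ} (σ : Finset (Fin n)) (x : {i // i ∈ σ} → Bool) (w : Fin n → Bool) :
    Fin n → Bool := fun j => if h : j ∈ σ then x ⟨j, h⟩ else w j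

/-- The low-dimensional skeleton `𝒞_d^n` of the solid cube `[-1,1]^n`. -/
def cubeSkeleton (n d : ℕ) : Set (Fin n → ℝ) :=
  {x | (∀ i, |x i| ≤ 1) ∧ n - d ≤ {i | |x i| = 1}.ncard}

/-- The `ℓ_p^d` norm on `ℝ^d`. -/
def lpnorm (p : ℝ) {d : ℕ} (v : Fin d → ℝ) : ℝ := (∑ k, |v k| ^ p) ^ (1 / p)

/-- Chains modulo two on the ordered simplices (lists of vertices) of `V`, augmented by the empty
simplex. -/
abbrev ListChain (V : Type*) := List V →₀ ZMod 2

namespace ListChain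

variable {V W A : Type*}

/-- The cone with apex `v` over a chain. -/
def cone (v : V) : ListChain V →ₗ[ZMod 2] ListChain V :=
  Finsupp.lmapDomain (ZMod 2) (ZMod 2) (List.cons v)

/-- The boundary of an ordered simplex. -/
def simplexBoundary : List V → ListChain V
  | [] => 0
  | v :: l => Finsupp.single l 1 + cone v (simplexBoundary l)

/-- The boundary operator. -/
def boundary : ListChain V →ₗ[ZMod 2] ListChain V :=
  Finsupp.linearCombination (ZMod 2) simplexBoundary

/-- The chain map induced by a map of vertices. -/
def map (f : V → W) : ListChain V →ₗ[ZMod 2] ListChain W :=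
  Finsupp.lmapDomain (ZMod 2) (ZMod 2) (List.map f)

@[simp] lemma cone_single (v : V) (l : List V) :
    cone v (Finsupp.single l 1) = Finsupp.single (v :: l) 1 := by
  simp [cone]

@[simp] lemma map_single (f : V → W) (l : List V) :
    map f (Finsupp.single l 1) = Finsupp.single (l.map f) 1 := by
  simp [map]

@[simp] lemma boundary_single (l : List V) :
    boundary (Finsupp.single l 1) = simplexBoundary l := by
  simp [boundary]

lemma add_self (c : ListChain V) : c + c = 0 := by
  ext l
  exact CharTwo.add_self_eq_zero _

lemma boundary_cone (v : V) (c : ListChain V) :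
    boundary (cone v c) = c + cone v (boundary c) := by
  have : boundary ∘ₗ cone v = LinearMap.id + cone v ∘ₗ boundary := by
    ext l : 2
    simp [simplexBoundary]
  exact LinearMap.congr_fun this c

lemma boundary_simplexBoundary (l : List V) : boundary (simplexBoundary l) = 0 := by
  induction l with
  | nil => simp [simplexBoundary]
  | cons v l ih => simp [simplexBoundary, boundary_cone, ih, add_self]

lemma map_cone (f : V → W) (v : V) (c : ListChain V) :
    map f (cone v c) = cone (f v) (map f c) := by
  have : map f ∘ₗ cone v = cone (f v) ∘ₗ map f := by
    ext l : 2
    simp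
  exact LinearMap.congr_fun this c

lemma map_simplexBoundary (f : V → W) (l : List V) :
    map f (simplexBoundary l) = simplexBoundary (l.map f) := by
  induction l with
  | nil => simp [simplexBoundary]
  | cons v l ih => simp [simplexBoundary, map_cone, ih]

lemma boundary_map (f : V → W) (c : ListChain V) :
    boundary (map f c) = map f (boundary c) := by
  have : boundary ∘ₗ map f = map f ∘ₗ boundary := by
    ext l : 2
    simp [map_simplexBoundary]
  exact LinearMap.congr_fun this c

/-- The coboundary of a cochain with values in a `ZMod 2`-module. -/
def coboundary [AddCommMonoid A] [Module (ZMod 2) A] (g : List V → A) (l : List V) : A :=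
  Finsupp.linearCombination (ZMod 2) g (simplexBoundary l)

section Coboundary

variable [AddCommMonoid A] [Module (ZMod 2) A]

@[simp] lemma coboundary_nil (g : List V → A) : coboundary g [] = 0 := by
  simp [coboundary, simplexBoundary]

@[simp] lemma coboundary_cons (g : List V → A) (v : V) (l : List V) :
    coboundary g (v :: l) = g l + coboundary (fun x => g (v :: x)) l := by
  simp [coboundary, simplexBoundary, cone, Finsupp.linearCombination_mapDomain, Function.comp_def]

@[simp] lemma coboundary_zero (l : List V) : coboundary (fun _ => (0 : A)) l = 0 :=
  Finsupp.linearCombination_zero_apply _ _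

lemma coboundary_comp_map (g : List W → A) (f : V → W) (l : List V) :
    coboundary (fun x => g (x.map f)) l = coboundary g (l.map f) := by
  induction l generalizing g with
  | nil => simp
  | cons v l ih => simp [← ih]

end Coboundary

lemma coboundary_filter_mul [Ring A] [Algebra (ZMod 2) A] (p : V → Bool) (g h : List V → A)
    (l : List V) :
    coboundary (fun x => g (x.filter p) * h (x.filter (fun v => !p v))) l =
      coboundary g (l.filter p) * h (l.filter (fun v => !p v)) +
        g (l.filter p) * coboundary h (l.filter (fun v => !p v)) := by
  induction l generalizing g h with
  | nil => simp
  | cons v l ih =>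
    cases hv : p v
    · have := ih g (fun x => h (v :: x))
      simp only [coboundary_cons, List.filter_cons, hv, Bool.not_false, if_true, Bool.false_eq_true,
        if_false] at this ⊢
      rw [this]
      noncomm_ring
    · have := ih (fun x => g (v :: x)) h
      simp only [coboundary_cons, List.filter_cons, hv, Bool.not_true, if_true, Bool.false_eq_true,
        if_false] at this ⊢
      rw [this]
      noncomm_ring

/-! ### A matrix-valued cochain detecting alternating simplices -/

/-- The `2 × 2` matrices over the field with two elements. -/
abbrev MatTwo := Matrix (Fin 2) (Fin 2) (ZMod 2)

/-- The matrix exchanging the two basis vectors. -/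
def swapMat : MatTwo := !![0, 1; 1, 0]

/-- The matrix unit attached to a sign. -/
def signMat (b : Bool) : MatTwo := if b then !![0, 1; 0, 0] else !![0, 0; 1, 0]

/-- The factor of `altCochain` contributed by the vertices with a given label. -/
def levelMat {L : Type*} : List (L × Bool) → MatTwo
  | [] => 1
  | [v] => signMat v.2
  | _ => 0

/-- The cochain on simplices with signed labels whose value is the product, in the order of the
labels `0, …, m - 1`, of the matrix units attached to the signs. It vanishes on simplices with a
repeated label or with a label outside this range. -/
def altCochain : ℕ → List (ℕ × Bool) → MatTwo
  | 0, l => if l = [] then 1 else 0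
  | m + 1, l => altCochain m (l.filter fun v => v.1 ≠ m) *
      levelMat (l.filter fun v => !decide (v.1 ≠ m))

lemma swapMat_mul_self : swapMat * swapMat = 1 := by decide

lemma mat_add_self (M : MatTwo) : M + M = 0 := by
  ext i j
  exact CharTwo.add_self_eq_zero _

lemma coboundary_levelMat {L : Type*} (l : List (L × Bool))
    (hl : ∀ v ∈ l, ∀ w ∈ l, v.2 = w.2) :
    coboundary levelMat l = swapMat * levelMat l + levelMat l * swapMat := by
  match l with
  | [] => simp [levelMat, mat_add_self]
  | [v] =>
    have : ∀ b, (1 : MatTwo) = swapMat * signMat b + signMat b * swapMat := by decide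
    simp [levelMat, ← this]
  | [v, w] =>
    have h : v.2 = w.2 := hl v (by simp) w (by simp)
    simp [levelMat, h, mat_add_self]
  | u :: v :: w :: l => simp [levelMat]

lemma coboundary_altCochain (m : ℕ) (l : List (ℕ × Bool)) (hm : ∀ v ∈ l, v.1 < m)
    (hl : ∀ v ∈ l, ∀ w ∈ l, v.1 = w.1 → v.2 = w.2) :
    coboundary (altCochain m) l = swapMat * altCochain m l + altCochain m l * swapMat := by
  induction m generalizing l with
  | zero =>
    have : l = [] := List.eq_nil_iff_forall_not_mem.2 fun v hv => by simpa using hm v hv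
    subst this
    simp [altCochain, mat_add_self]
  | succ m ih =>
    have h1 := ih (l.filter fun v => v.1 ≠ m)
      (fun v hv => by
        simp only [List.mem_filter, decide_eq_true_eq] at hv
        have := hm v hv.1
        omega)
      (fun v hv w hw => hl v (List.mem_of_mem_filter hv) w (List.mem_of_mem_filter hw))
    have h2 := coboundary_levelMat (l.filter fun v => !decide (v.1 ≠ m))
      (fun v hv w hw => by
        simp only [List.mem_filter] at hv hw
        exact hl v hv.1 w hw.1 (by simp_all))
    have h0 : altCochain (m + 1) = fun x => altCochain m (x.filter fun v => v.1 ≠ m) *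
        levelMat (x.filter fun v => !decide (v.1 ≠ m)) := rfl
    rw [h0, coboundary_filter_mul, h1, h2]
    beta_reduce
    generalize altCochain m _ = X
    generalize levelMat _ = Y
    have h3 : X * swapMat * Y + X * (swapMat * Y) = 0 := by rw [← mul_assoc, mat_add_self]
    calc _ = swapMat * (X * Y) + X * Y * swapMat + (X * swapMat * Y + X * (swapMat * Y)) := by
          noncomm_ring
      _ = _ := by rw [h3, add_zero]

lemma altCochain_eq_zero (m : ℕ) (l : List (ℕ × Bool)) (h : m < l.length) :
    altCochain m l = 0 := by
  induction m generalizing l with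
  | zero => simp [altCochain, List.ne_nil_of_length_pos h]
  | succ m ih =>
    unfold altCochain
    have hlen := l.length_eq_length_filter_add (fun v => decide (v.1 ≠ m))
    by_cases h1 : m < (l.filter fun v => decide (v.1 ≠ m)).length
    · rw [ih _ h1, zero_mul]
    · have h2 : 1 < (l.filter fun v => !decide (v.1 ≠ m)).length := by omega
      revert h2
      generalize (l.filter fun v => !decide (v.1 ≠ m)) = l'
      intro h2
      match l', h2 with
      | u :: v :: l'', _ => simp [levelMat]

/-- Reversal of the sign of a label. -/
def flipSign (v : ℕ × Bool) : ℕ × Bool := (v.1, !v.2)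

lemma altCochain_flipSign (m : ℕ) (l : List (ℕ × Bool)) :
    altCochain m (l.map flipSign) = swapMat * altCochain m l * swapMat := by
  have hlevel : ∀ l : List (ℕ × Bool),
      levelMat (l.map flipSign) = swapMat * levelMat l * swapMat := by
    intro l
    match l with
    | [] => simp [levelMat, swapMat_mul_self]
    | [v] =>
      have : ∀ b, signMat (!b) = swapMat * signMat b * swapMat := by decide
      simp [levelMat, flipSign, this]
    | u :: v :: l => simp [levelMat]
  induction m generalizing l with
  | zero =>
    by_cases h : l = [] <;> simp [altCochain, h, swapMat_mul_self]
  | succ m ih =>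
    unfold altCochain
    have h1 : (fun v : ℕ × Bool => decide (v.1 ≠ m)) ∘ flipSign = fun v => decide (v.1 ≠ m) := rfl
    have h2 : (fun v : ℕ × Bool => !decide (v.1 ≠ m)) ∘ flipSign =
        fun v => !decide (v.1 ≠ m) := rfl
    rw [List.filter_map, List.filter_map, ih, hlevel, h1, h2]
    generalize altCochain m _ = X
    generalize levelMat _ = Y
    calc _ = swapMat * X * (swapMat * swapMat) * Y * swapMat := by simp only [mul_assoc]
      _ = _ := by rw [swapMat_mul_self, mul_one]; simp only [mul_assoc]

/-! ### Supports of chains -/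

/-- The chains supported on a set of simplices. -/
abbrev supportedOn (S : Set (List V)) : Submodule (ZMod 2) (ListChain V) :=
  Finsupp.supported (ZMod 2) (ZMod 2) S

lemma map_mem_of_mem_supportedOn {M : Type*} [AddCommMonoid M] [Module (ZMod 2) M]
    {S : Set (List V)} (f : ListChain V →ₗ[ZMod 2] M) (p : Submodule (ZMod 2) M)
    (h : ∀ l ∈ S, f (Finsupp.single l 1) ∈ p) {c : ListChain V} (hc : c ∈ supportedOn S) :
    f c ∈ p := by
  rw [supportedOn, Finsupp.supported_eq_span_single] at hc
  refine (Submodule.span_le (p := p.comap f)).2 ?_ hc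
  rintro _ ⟨l, hl, rfl⟩
  exact h l hl

lemma eq_of_mem_supportedOn {M : Type*} [AddCommMonoid M] [Module (ZMod 2) M]
    {S : Set (List V)} (f g : ListChain V →ₗ[ZMod 2] M)
    (h : ∀ l ∈ S, f (Finsupp.single l 1) = g (Finsupp.single l 1)) {c : ListChain V}
    (hc : c ∈ supportedOn S) : f c = g c := by
  rw [supportedOn, Finsupp.supported_eq_span_single] at hc
  refine (Submodule.span_le (p := LinearMap.eqLocus f g)).2 ?_ hc
  rintro _ ⟨l, hl, rfl⟩
  exact h l hl

lemma cone_mem_supportedOn {S T : Set (List V)} {v : V} (h : ∀ l ∈ S, v :: l ∈ T)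
    {c : ListChain V} (hc : c ∈ supportedOn S) : cone v c ∈ supportedOn T :=
  map_mem_of_mem_supportedOn _ _
    (fun l hl => by simpa using Finsupp.single_mem_supported (ZMod 2) 1 (h l hl)) hc

lemma map_mem_supportedOn {S : Set (List V)} {T : Set (List W)} {f : V → W}
    (h : ∀ l ∈ S, l.map f ∈ T) {c : ListChain V} (hc : c ∈ supportedOn S) :
    map f c ∈ supportedOn T :=
  map_mem_of_mem_supportedOn _ _
    (fun l hl => by simpa using Finsupp.single_mem_supported (ZMod 2) 1 (h l hl)) hc

lemma simplexBoundary_mem_supportedOn (l : List V) {n : ℕ} (hn : l.length = n + 1) :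
    simplexBoundary l ∈ supportedOn {x | x.length = n ∧ x ⊆ l} := by
  induction l generalizing n with
  | nil => simp at hn
  | cons v l ih =>
    have hn' : l.length = n := by simpa using hn
    refine add_mem (Finsupp.single_mem_supported _ _ ⟨hn', List.subset_cons_self v l⟩) ?_
    cases n with
    | zero =>
      rw [List.length_eq_zero_iff] at hn'
      simp [hn', simplexBoundary]
    | succ n =>
      refine cone_mem_supportedOn ?_ (ih hn')
      rintro x ⟨hx, hxl⟩
      exact ⟨by simp [hx], List.cons_subset_cons v hxl⟩

/-- A combinatorial Borsuk–Ulam theorem, in the spirit of the lemmas of Tucker and Fan. -/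
theorem exists_complementary_labels [Neg V] (d : ℕ) (lab : V → ℕ × Bool) (c : ℕ → ListChain V)
    (S : ℕ → Set (List V)) (hc : ∀ k ≤ d, c k ∈ supportedOn (S k))
    (hS : ∀ k ≤ d, ∀ l ∈ S k, l.length = k + 1 ∧
      ∀ v ∈ l, (lab v).1 < d ∧ lab (-v) = flipSign (lab v))
    (h0 : boundary (c 0) = Finsupp.single [] 1)
    (hsucc : ∀ k < d, boundary (c (k + 1)) = c k + map (fun v => -v) (c k)) :
    ∃ k ≤ d, ∃ l ∈ S k, ∃ v ∈ l, ∃ w ∈ l, lab w = flipSign (lab v) := by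
  by_contra! hcon
  let ev : ListChain V →ₗ[ZMod 2] MatTwo :=
    Finsupp.linearCombination (ZMod 2) fun l => altCochain d (l.map lab)
  have hev : ∀ l, ev (Finsupp.single l 1) = altCochain d (l.map lab) := fun l => by simp [ev]
  have hboundary : ∀ k ≤ d, ev (boundary (c k)) = swapMat * ev (c k) + ev (c k) * swapMat := by
    intro k hk
    refine eq_of_mem_supportedOn (ev ∘ₗ boundary)
      (LinearMap.mulLeft (ZMod 2) swapMat ∘ₗ ev + LinearMap.mulRight (ZMod 2) swapMat ∘ₗ ev)
      (fun l hl => ?_) (hc k hk)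
    have h1 : ev (simplexBoundary l) = coboundary (altCochain d) (l.map lab) :=
      coboundary_comp_map (altCochain d) lab l
    simp only [LinearMap.comp_apply, LinearMap.add_apply, LinearMap.mulLeft_apply,
      LinearMap.mulRight_apply, boundary_single, hev, h1]
    refine coboundary_altCochain d _ ?_ ?_
    · simp only [List.mem_map]
      rintro _ ⟨v, hv, rfl⟩
      exact ((hS k hk l hl).2 v hv).1
    · simp only [List.mem_map]
      rintro _ ⟨v, hv, rfl⟩ _ ⟨w, hw, rfl⟩ h
      by_contra hne
      refine hcon k hk l hl v hv w hw (Prod.ext h.symm ?_)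
      simpa [flipSign, Bool.eq_not] using Ne.symm hne
  have hneg : ∀ k ≤ d, ev (map (fun v => -v) (c k)) = swapMat * ev (c k) * swapMat := by
    intro k hk
    refine eq_of_mem_supportedOn (ev ∘ₗ map fun v => -v)
      (LinearMap.mulRight (ZMod 2) swapMat ∘ₗ LinearMap.mulLeft (ZMod 2) swapMat ∘ₗ ev)
      (fun l hl => ?_) (hc k hk)
    simp only [LinearMap.comp_apply, LinearMap.mulLeft_apply, LinearMap.mulRight_apply,
      map_single, hev, ← altCochain_flipSign, List.map_map]
    congr 1
    exact List.map_congr_left fun v hv => ((hS k hk l hl).2 v hv).2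
  have hinv : ∀ k ≤ d, swapMat * ev (c k) + ev (c k) * swapMat ≠ 0 := by
    intro k hk
    induction k with
    | zero =>
      rw [← hboundary 0 hk, h0, hev]
      have : ∀ m, altCochain m [] = 1 := by
        intro m
        induction m with
        | zero => simp [altCochain]
        | succ m ih => simp [altCochain, ih, levelMat]
      simp [this]
    | succ k ih =>
      intro h
      rw [← hboundary (k + 1) hk, hsucc k hk, map_add, hneg k (by omega)] at h
      refine ih (by omega) ?_
      calc swapMat * ev (c k) + ev (c k) * swapMat
          = (ev (c k) + swapMat * ev (c k) * swapMat) * swapMat := by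
            rw [add_mul, mul_assoc _ swapMat swapMat, swapMat_mul_self, mul_one, add_comm]
        _ = 0 := by rw [h, zero_mul]
  have hzero : ev (c d) = 0 := by
    refine eq_of_mem_supportedOn ev 0 (fun l hl => ?_) (hc d le_rfl)
    rw [hev, altCochain_eq_zero _ _ (by simp [(hS d le_rfl l hl).1])]
    rfl
  exact hinv d le_rfl (by simp [hzero])

/-! ### Barycentric subdivision -/

section Subdivision

variable {E : Type*} [NormedAddCommGroup E] [NormedSpace ℝ E]

/-- The barycenter of a simplex. -/
def barycenter (l : List E) : E := (l.length : ℝ)⁻¹ • l.sum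

/-- The barycentric subdivision operator on simplices with `n` vertices. -/
def subdivision : ℕ → ListChain E →ₗ[ZMod 2] ListChain E
  | 0 => LinearMap.id
  | n + 1 => Finsupp.linearCombination (ZMod 2) fun l =>
      cone (barycenter l) (subdivision n (simplexBoundary l))

lemma subdivision_succ_single (n : ℕ) (l : List E) :
    subdivision (n + 1) (Finsupp.single l 1) =
      cone (barycenter l) (subdivision n (simplexBoundary l)) := by
  simp [subdivision]

lemma boundary_subdivision (n : ℕ) (c : ListChain E) :
    boundary (subdivision (n + 1) c) = subdivision n (boundary c) := by
  have : boundary ∘ₗ subdivision (n + 1) = subdivision n ∘ₗ boundary (V := E) := by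
    induction n with
    | zero =>
      ext l : 2
      simp [subdivision, boundary_cone, boundary_simplexBoundary]
    | succ n ih =>
      ext l : 2
      have := LinearMap.congr_fun ih (simplexBoundary l)
      simp only [LinearMap.comp_apply, boundary_simplexBoundary, _root_.map_zero] at this
      simp [subdivision_succ_single, boundary_cone, this]
  exact LinearMap.congr_fun this c

lemma barycenter_map_neg (l : List E) : barycenter (l.map fun v => -v) = -barycenter l := by
  have : (l.map fun v => -v).sum = -l.sum := by
    induction l with
    | nil => simp
    | cons v l ih => simp [ih, add_comm]
  simp [barycenter, this]

lemma map_neg_subdivision (n : ℕ) (c : ListChain E) :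
    map (fun v => -v) (subdivision n c) = subdivision n (map (fun v => -v) c) := by
  have : map (fun v => -v) ∘ₗ subdivision n = subdivision n ∘ₗ map fun v : E => -v := by
    induction n with
    | zero => rfl
    | succ n ih =>
      ext l : 2
      have := LinearMap.congr_fun ih (simplexBoundary l)
      simp only [LinearMap.comp_apply] at this
      simp [subdivision_succ_single, map_cone, this, map_simplexBoundary, barycenter_map_neg]
  exact LinearMap.congr_fun this c

lemma barycenter_mem {C : Set E} (hC : Convex ℝ C) {l : List E} (hl : l ≠ [])
    (h : ∀ v ∈ l, v ∈ C) : barycenter l ∈ C := by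
  have hlen : (l.length : ℝ) ≠ 0 := by simpa using hl
  rw [barycenter, ← Fin.sum_univ_getElem, Finset.smul_sum]
  refine hC.sum_mem (fun _ _ => by positivity) ?_ fun i _ => h _ (List.getElem_mem _)
  simp [hlen]

lemma dist_barycenter_le {l : List E} {n : ℕ} (hn : l.length = n + 1) {D : ℝ} {v : E}
    (hv : v ∈ l) (hD : ∀ w ∈ l, dist v w ≤ D) : dist v (barycenter l) ≤ n / (n + 1) * D := by
  have key : ∀ l : List E, (∀ w ∈ l, dist v w ≤ D) →
      ‖l.sum - (l.length : ℝ) • v‖ ≤ l.length * D := by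
    intro l hl
    induction l with
    | nil => simp
    | cons w l ih =>
      have h1 := ih fun x hx => hl x (List.mem_cons_of_mem _ hx)
      have h2 := hl w List.mem_cons_self
      rw [dist_comm, dist_eq_norm] at h2
      have h3 : (w :: l).sum - ((w :: l).length : ℝ) • v =
          (w - v) + (l.sum - (l.length : ℝ) • v) := by
        simp only [List.sum_cons, List.length_cons, Nat.cast_add, Nat.cast_one]
        module
      rw [h3]
      refine (norm_add_le _ _).trans ?_
      simp only [List.length_cons, Nat.cast_add, Nat.cast_one]
      linarith
  classical
  have hperm := List.perm_cons_erase hv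
  have hlen : (l.erase v).length = n := by rw [List.length_erase_of_mem hv, hn]; rfl
  have h := key (l.erase v) fun w hw => hD w (List.mem_of_mem_erase hw)
  rw [hlen] at h
  have hn0 : (n : ℝ) + 1 ≠ 0 := by positivity
  have hb : barycenter l - v = ((n : ℝ) + 1)⁻¹ • ((l.erase v).sum - (n : ℝ) • v) := by
    rw [eq_inv_smul_iff₀ hn0, barycenter, hperm.sum_eq, hn, List.sum_cons, smul_sub, Nat.cast_add,
      Nat.cast_one, smul_inv_smul₀ hn0]
    module
  rw [dist_comm, dist_eq_norm, hb, norm_smul, Real.norm_of_nonneg (by positivity)]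
  calc _ ≤ ((n : ℝ) + 1)⁻¹ * (n * D) := by gcongr
    _ = _ := by ring

/-- The simplices with `n` vertices, all in `C`, at mutual distance at most `D`. -/
def smallSimplices (C : Set E) (n : ℕ) (D : ℝ) : Set (List E) :=
  {l | l.length = n ∧ (∀ v ∈ l, v ∈ C) ∧ ∀ v ∈ l, ∀ w ∈ l, dist v w ≤ D}

lemma subdivision_single_mem {d n : ℕ} (hn : n ≤ d + 1) {C : Set E} (hC : Convex ℝ C) {D : ℝ}
    {l : List E} (hl : l ∈ smallSimplices C n D) :
    subdivision n (Finsupp.single l 1) ∈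
      supportedOn (smallSimplices C n ((d : ℝ) / (d + 1) * D)) := by
  induction n generalizing C l with
  | zero =>
    obtain rfl := List.length_eq_zero_iff.1 hl.1
    exact Finsupp.single_mem_supported _ _ ⟨rfl, by simp, by simp⟩
  | succ n ih =>
    obtain ⟨hlen, hlC, hlD⟩ := hl
    have hne : l ≠ [] := List.ne_nil_of_length_pos (by omega)
    have hD : 0 ≤ D := by
      obtain ⟨v, hv⟩ := List.exists_mem_of_ne_nil l hne
      exact dist_nonneg.trans (hlD v hv v hv)
    have hfrac : (n : ℝ) / (n + 1) * D ≤ d / (d + 1) * D := by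
      have : (n : ℝ) ≤ d := by exact_mod_cast Nat.le_of_succ_le_succ hn
      gcongr ?_ * D
      rw [div_le_div_iff₀ (by positivity) (by positivity)]
      linarith
    rw [subdivision_succ_single]
    have hC' : Convex ℝ (C ∩ Metric.closedBall (barycenter l) ((n : ℝ) / (n + 1) * D)) :=
      hC.inter (convex_closedBall _ _)
    refine cone_mem_supportedOn ?_ (map_mem_of_mem_supportedOn (subdivision n) _
      (fun x hx => ih (by omega) hC' (l := x) ?_) (simplexBoundary_mem_supportedOn l hlen))
    · rintro x ⟨hx, hxC, hxD⟩
      refine ⟨by simp [hx], ?_, ?_⟩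
      · rintro v (_ | ⟨_, hv⟩)
        · exact barycenter_mem hC hne hlC
        · exact (hxC v hv).1
      · have hb : ∀ v ∈ x, dist v (barycenter l) ≤ d / (d + 1) * D :=
          fun v hv => (Metric.mem_closedBall.1 (hxC v hv).2).trans hfrac
        rintro v (_ | ⟨_, hv⟩) w (_ | ⟨_, hw⟩)
        · rw [dist_self]; positivity
        · rw [dist_comm]; exact hb w hw
        · exact hb v hv
        · exact hxD v hv w hw
    · obtain ⟨hx1, hx2⟩ := hx
      exact ⟨hx1, fun v hv => ⟨hlC v (hx2 hv), Metric.mem_closedBall.2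
        (dist_barycenter_le hlen (hx2 hv) fun w hw => hlD v (hx2 hv) w hw)⟩,
        fun v hv w hw => hlD v (hx2 hv) w (hx2 hw)⟩

/-- The simplices with `n` vertices which lie in some member of a family of sets, with vertices at
mutual distance at most `D`. -/
def facialSimplices (𝒞 : Set (Set E)) (n : ℕ) (D : ℝ) : Set (List E) :=
  {l | ∃ C ∈ 𝒞, l ∈ smallSimplices C n D}

lemma subdivision_iterate_mem {𝒞 : Set (Set E)} (h𝒞 : ∀ C ∈ 𝒞, Convex ℝ C) {d n : ℕ}
    (hn : n ≤ d + 1) {D : ℝ} {c : ListChain E} (hc : c ∈ supportedOn (facialSimplices 𝒞 n D))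
    (r : ℕ) :
    (subdivision n)^[r] c ∈
      supportedOn (facialSimplices 𝒞 n (((d : ℝ) / (d + 1)) ^ r * D)) := by
  induction r with
  | zero => simpa using hc
  | succ r ih =>
    rw [Function.iterate_succ_apply', pow_succ', mul_assoc]
    refine map_mem_of_mem_supportedOn _ _ ?_ ih
    rintro l ⟨C, hC, hl⟩
    have hsub : ∀ D, smallSimplices C n D ⊆ facialSimplices 𝒞 n D := fun _ x hx => ⟨C, hC, hx⟩
    exact Finsupp.supported_mono (hsub _) (subdivision_single_mem hn (h𝒞 C hC) hl)

lemma boundary_subdivision_iterate (n r : ℕ) (c : ListChain E) :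
    boundary ((subdivision (n + 1))^[r] c) = (subdivision n)^[r] (boundary c) :=
  (Function.Semiconj.iterate_right (f := boundary) (boundary_subdivision n) r) c

lemma map_neg_subdivision_iterate (n r : ℕ) (c : ListChain E) :
    map (fun v => -v) ((subdivision n)^[r] c) = (subdivision n)^[r] (map (fun v => -v) c) :=
  (Function.Semiconj.iterate_right (f := map fun v : E => -v) (map_neg_subdivision n) r) c

end Subdivision

/-! ### The cross-polytope -/

section CrossPolytope

variable {m : ℕ}

/-- The `k`-th standard basis vector, for a natural number `k`. -/
def basisVec (m k : ℕ) : Fin m → ℝ := fun j => if (j : ℕ) = k then 1 else 0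

/-- A chain formed by the simplices of a `k`-dimensional hemisphere in the boundary of the
cross-polytope. -/
def hemisphere (m : ℕ) : ℕ → ListChain (Fin m → ℝ)
  | 0 => Finsupp.single [basisVec m 0] 1
  | k + 1 => cone (basisVec m (k + 1)) (hemisphere m k + map (fun v => -v) (hemisphere m k))

lemma boundary_hemisphere_zero : boundary (hemisphere m 0) = Finsupp.single [] 1 := by
  simp [hemisphere, simplexBoundary]

lemma map_neg_map_neg (c : ListChain (Fin m → ℝ)) :
    map (fun v => -v) (map (fun v => -v) c) = c := by
  have : map (fun v => -v) ∘ₗ map (fun v => -v) =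
      (LinearMap.id : ListChain (Fin m → ℝ) →ₗ[ZMod 2] _) := by
    ext l : 2
    simp
  exact LinearMap.congr_fun this c

lemma boundary_hemisphere_succ (k : ℕ) :
    boundary (hemisphere m (k + 1)) = hemisphere m k + map (fun v => -v) (hemisphere m k) := by
  have key : boundary (hemisphere m k + map (fun v => -v) (hemisphere m k)) = 0 := by
    induction k with
    | zero => simp [boundary_map, boundary_hemisphere_zero, add_self]
    | succ k ih =>
      have h : boundary (hemisphere m (k + 1)) =
          hemisphere m k + map (fun v => -v) (hemisphere m k) := by
        rw [hemisphere, boundary_cone, ih, _root_.map_zero, add_zero]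
      rw [map_add, boundary_map, h, map_add, map_neg_map_neg,
        add_comm (map _ _) (hemisphere m k), add_self]
  rw [hemisphere, boundary_cone, key, _root_.map_zero, add_zero]

/-- The closed facet of the boundary of the cross-polytope with signs `s`. -/
def facet (s : Fin m → ℝ) : Set (Fin m → ℝ) := {x | (∀ j, 0 ≤ s j * x j) ∧ ∑ j, s j * x j = 1}

/-- The closed facets of the boundary of the cross-polytope. -/
def facets (m : ℕ) : Set (Set (Fin m → ℝ)) := {C | ∃ s, (∀ j, |s j| = 1) ∧ C = facet s}

lemma convex_of_mem_facets {C : Set (Fin m → ℝ)} (hC : C ∈ facets m) : Convex ℝ C := by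
  obtain ⟨s, -, rfl⟩ := hC
  intro x hx y hy a b ha hb hab
  refine ⟨fun j => ?_, ?_⟩
  · have := add_nonneg (mul_nonneg ha (hx.1 j)) (mul_nonneg hb (hy.1 j))
    simp only [Pi.add_apply, Pi.smul_apply, smul_eq_mul]
    linarith
  · calc ∑ j, s j * (a • x + b • y) j = a * ∑ j, s j * x j + b * ∑ j, s j * y j := by
          rw [Finset.mul_sum, Finset.mul_sum, ← Finset.sum_add_distrib]
          refine Finset.sum_congr rfl fun j _ => ?_
          simp only [Pi.add_apply, Pi.smul_apply, smul_eq_mul]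
          ring
      _ = 1 := by rw [hx.2, hy.2]; linarith

lemma sum_abs_of_mem_facets {C : Set (Fin m → ℝ)} (hC : C ∈ facets m) {x : Fin m → ℝ}
    (hx : x ∈ C) : ∑ j, |x j| = 1 := by
  obtain ⟨s, hs, rfl⟩ := hC
  rw [← hx.2]
  refine Finset.sum_congr rfl fun j _ => ?_
  rw [← abs_of_nonneg (hx.1 j), abs_mul, hs, one_mul]

lemma abs_le_one_of_sum_abs {x : Fin m → ℝ} (hx : ∑ j, |x j| = 1) (j : Fin m) : |x j| ≤ 1 :=
  hx ▸ Finset.single_le_sum (f := fun j => |x j|) (fun _ _ => abs_nonneg _) (Finset.mem_univ j)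

lemma dist_le_two_of_sum_abs {x y : Fin m → ℝ} (hx : ∑ j, |x j| = 1) (hy : ∑ j, |y j| = 1) :
    dist x y ≤ 2 := by
  refine (dist_pi_le_iff zero_le_two).2 fun j => ?_
  rw [Real.dist_eq]
  have h1 := abs_le_one_of_sum_abs hx j
  have h2 := abs_le_one_of_sum_abs hy j
  have := abs_sub (x j) (y j)
  linarith

lemma hemisphere_mem {k : ℕ} (hk : k < m) :
    hemisphere m k ∈ supportedOn (facialSimplices (facets m) (k + 1) 2) := by
  let T : ℕ → Set (List (Fin m → ℝ)) := fun k => {l | l.length = k + 1 ∧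
    ∃ s : ℕ → ℝ, (∀ j, |s j| = 1) ∧ ∀ v ∈ l, ∃ j ≤ k, v = s j • basisVec m j}
  have hT : hemisphere m k ∈ supportedOn (T k) := by
    clear hk
    induction k with
    | zero =>
      refine Finsupp.single_mem_supported _ _ ⟨rfl, fun _ => 1, by simp, ?_⟩
      intro v hv
      exact ⟨0, le_rfl, by simpa using hv⟩
    | succ k ih =>
      have hcone : ∀ l ∈ T k, basisVec m (k + 1) :: l ∈ T (k + 1) := by
        rintro l ⟨hl, s, hs, hls⟩
        refine ⟨by simp [hl], fun j => if j = k + 1 then 1 else s j, fun j => ?_, ?_⟩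
        · dsimp only
          split_ifs
          · simp
          · exact hs j
        · rintro v (_ | ⟨_, hv⟩)
          · exact ⟨k + 1, le_rfl, by simp⟩
          · obtain ⟨j, hj, rfl⟩ := hls v hv
            exact ⟨j, by omega, by simp [show j ≠ k + 1 by omega]⟩
      refine cone_mem_supportedOn hcone (add_mem ih (map_mem_supportedOn ?_ ih))
      rintro l ⟨hl, s, hs, hls⟩
      refine ⟨by simp [hl], fun j => -s j, by simpa using hs, ?_⟩
      simp only [List.mem_map]
      rintro _ ⟨v, hv, rfl⟩
      obtain ⟨j, hj, rfl⟩ := hls v hv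
      exact ⟨j, hj, by simp⟩
  refine Finsupp.supported_mono ?_ hT
  rintro l ⟨hl, s, hs, hls⟩
  have hC : facet (fun j : Fin m => s j) ∈ facets m := ⟨_, fun j => hs j, rfl⟩
  have hmem : ∀ v ∈ l, v ∈ facet (fun j : Fin m => s j) := by
    intro v hv
    obtain ⟨j, hj, rfl⟩ := hls v hv
    have hval : ∀ i : Fin m, s i * (s j • basisVec m j) i = if i = ⟨j, by omega⟩ then 1 else 0 := by
      intro i
      have hss : s j * s j = 1 := by rw [← abs_mul_abs_self, hs, one_mul]
      by_cases hij : (i : ℕ) = j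
      · simp [basisVec, Fin.ext_iff, hij, hss]
      · simp [basisVec, Fin.ext_iff, hij]
    refine ⟨fun i => ?_, ?_⟩
    · rw [hval]
      positivity
    · rw [Finset.sum_congr rfl fun i _ => hval i]
      simp
  exact ⟨_, hC, hl, hmem, fun v hv w hw => dist_le_two_of_sum_abs
    (sum_abs_of_mem_facets hC (hmem v hv)) (sum_abs_of_mem_facets hC (hmem w hw))⟩

end CrossPolytope

end ListChain

open ListChain in
/-- The Borsuk–Ulam theorem on the boundary of the cross-polytope. -/
theorem exists_eq_zero_of_odd_on_crossPolytope {d : ℕ} (hd : 0 < d)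
    (h : (Fin (d + 1) → ℝ) → (Fin d → ℝ)) (hcont : ContinuousOn h {x | ∑ j, |x j| = 1})
    (hodd : ∀ x, ∑ j, |x j| = 1 → h (-x) = -h x) :
    ∃ x, ∑ j, |x j| = 1 ∧ h x = 0 := by
  by_contra! hne
  set L : Set (Fin (d + 1) → ℝ) := {x | ∑ j, |x j| = 1} with hL
  have hcompact : IsCompact L := by
    refine Metric.isCompact_of_isClosed_isBounded
      (isClosed_eq (by fun_prop) continuous_const) ?_
    exact Metric.isBounded_iff.2 ⟨2, fun x hx y hy => dist_le_two_of_sum_abs hx hy⟩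
  obtain ⟨ε, hε, hεL⟩ : ∃ ε > 0, ∀ x ∈ L, ε ≤ ‖h x‖ := by
    rcases L.eq_empty_or_nonempty with hemp | hnonempty
    · exact ⟨1, one_pos, by simp [hemp]⟩
    · obtain ⟨x, hx, hmin⟩ := hcompact.exists_isMinOn hnonempty hcont.norm
      exact ⟨‖h x‖, norm_pos_iff.2 (hne x hx), hmin⟩
  obtain ⟨δ, hδ, hδL⟩ := Metric.uniformContinuousOn_iff.1
    (hcompact.uniformContinuousOn_of_continuous hcont) ε hε
  have hidx : ∀ a : Fin d → ℝ, ∃ i, (∃ j, ε ≤ a j) → ε ≤ a i := by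
    intro a
    by_cases ha : ∃ j, ε ≤ a j
    · exact ⟨ha.choose, fun _ => ha.choose_spec⟩
    · exact ⟨⟨0, hd⟩, fun h => absurd h ha⟩
  choose idx hidx using hidx
  let ind : (Fin (d + 1) → ℝ) → Fin d := fun x => idx fun j => |h x j|
  let lab : (Fin (d + 1) → ℝ) → ℕ × Bool := fun x => (ind x, decide (0 < h x (ind x)))
  have hind : ∀ x ∈ L, ε ≤ |h x (ind x)| := by
    intro x hx
    refine hidx (fun j => |h x j|) ?_
    by_contra! hlt
    exact absurd (hεL x hx) (not_le.2 ((pi_norm_lt_iff hε).2 hlt))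
  have hlab : ∀ x ∈ L, lab (-x) = flipSign (lab x) := by
    intro x hx
    have hi : ind (-x) = ind x := by simp only [ind, hodd x hx, Pi.neg_apply, abs_neg]
    have hx0 : h x (ind x) ≠ 0 := abs_pos.1 (hε.trans_le (hind x hx))
    simp only [lab, flipSign, hi, hodd x hx, Pi.neg_apply, Prod.mk.injEq, true_and]
    rw [← decide_not, decide_eq_decide, not_lt, neg_pos]
    exact ⟨le_of_lt, fun hle => lt_of_le_of_ne hle hx0⟩
  have hclose : ∀ x ∈ L, ∀ y ∈ L, dist x y < δ → lab y ≠ flipSign (lab x) := by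
    intro x hx y hy hxy heq
    simp only [lab, flipSign, Prod.mk.injEq, Fin.val_inj] at heq
    obtain ⟨hi, hs⟩ := heq
    have h1 := hind x hx
    have h2 := hind y hy
    have h3 := (dist_le_pi_dist (h x) (h y) (ind x)).trans_lt (hδL x hx y hy hxy)
    rw [hi] at hs h2
    rw [← decide_not, decide_eq_decide, not_lt] at hs
    rw [Real.dist_eq, abs_lt] at h3
    rcases lt_or_ge 0 (h x (ind x)) with hpos | hneg
    · have hy0 : h y (ind x) ≤ 0 := not_lt.1 fun hy0 => absurd (hs.1 hy0) (not_le.2 hpos)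
      rw [abs_of_pos hpos] at h1
      linarith
    · have hy0 := hs.2 hneg
      rw [abs_of_nonpos hneg] at h1
      linarith
  obtain ⟨r, hr⟩ : ∃ r : ℕ, ((d : ℝ) / (d + 1)) ^ r < δ / 2 :=
    exists_pow_lt_of_lt_one (by positivity) ((div_lt_one (by positivity)).2 (by linarith))
  obtain ⟨k, hk, l, ⟨C, hC, hl⟩, v, hv, w, hw, hvw⟩ :=
    exists_complementary_labels d lab
      (fun k => (subdivision (k + 1))^[r] (hemisphere (d + 1) k))
      (fun k => facialSimplices (facets (d + 1)) (k + 1) (((d : ℝ) / (d + 1)) ^ r * 2))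
      (fun k hk => subdivision_iterate_mem (fun _ => convex_of_mem_facets) (by omega)
        (hemisphere_mem (by omega)) r)
      (by
        rintro k hk l ⟨C, hC, hl⟩
        exact ⟨hl.1, fun v hv => ⟨(ind v).2, hlab v (sum_abs_of_mem_facets hC (hl.2.1 v hv))⟩⟩)
      (by
        rw [boundary_subdivision_iterate, boundary_hemisphere_zero]
        exact congr_fun (Function.iterate_id r) _)
      (by
        intro k hk
        rw [boundary_subdivision_iterate, boundary_hemisphere_succ, iterate_map_add,
          map_neg_subdivision_iterate])
  refine hclose v (sum_abs_of_mem_facets hC (hl.2.1 v hv)) w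
    (sum_abs_of_mem_facets hC (hl.2.1 w hw)) ?_ hvw
  have := hl.2.2 v hv w hw
  linarith

/-! ### A symmetric sphere in the skeleton of the cube -/

/-- The truncation of a real number to `[-1, 1]`. -/
def clampUnit (y : ℝ) : ℝ := max (-1) (min 1 y)

lemma clampUnit_neg (y : ℝ) : clampUnit (-y) = -clampUnit y := by
  unfold clampUnit
  grind

lemma abs_clampUnit_le (y : ℝ) : |clampUnit y| ≤ 1 :=
  abs_le.2 ⟨le_max_left _ _, max_le (by norm_num) (min_le_left _ _)⟩

lemma abs_lt_one_of_abs_clampUnit_ne {y : ℝ} (h : |clampUnit y| ≠ 1) : |y| < 1 := by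
  contrapose! h
  rcases le_abs.1 h with h | h
  · simp [clampUnit, h]
  · rw [← abs_neg, ← clampUnit_neg]
    simp [clampUnit, h]

lemma continuous_clampUnit : Continuous clampUnit := by
  unfold clampUnit
  fun_prop

/-- The value at `i` of the polynomial with coefficients `x`. -/
def polyValue {m : ℕ} (x : Fin m → ℝ) (i : ℕ) : ℝ := ∑ j, x j * (i : ℝ) ^ (j : ℕ)

lemma polyValue_neg {m : ℕ} (x : Fin m → ℝ) (i : ℕ) : polyValue (-x) i = -polyValue x i := by
  simp [polyValue]

lemma exists_odd_map_to_cubeSkeleton {d n : ℕ} (hdn : d < n) :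
    ∃ g : (Fin (d + 1) → ℝ) → (Fin n → ℝ), ContinuousOn g {x | ∑ j, |x j| = 1} ∧
      ∀ x, ∑ j, |x j| = 1 → g x ∈ cubeSkeleton n d ∧ g (-x) = -g x := by
  have hne : ((Finset.univ : Finset (Fin n)).powersetCard (d + 1)).Nonempty :=
    Finset.powersetCard_nonempty.2 (by simpa using hdn)
  let w : Finset (Fin n) → (Fin (d + 1) → ℝ) → ℝ := fun S x => ∑ i ∈ S, |polyValue x i|
  let μ : (Fin (d + 1) → ℝ) → ℝ := fun x =>
    ((Finset.univ : Finset (Fin n)).powersetCard (d + 1)).inf' hne fun S => w S x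
  have hval : ∀ i, Continuous fun x : Fin (d + 1) → ℝ => polyValue x i := by
    intro i
    unfold polyValue
    fun_prop
  have hμcont : Continuous μ := Continuous.finset_inf'_apply hne fun S _ =>
    continuous_finsetSum _ fun i _ => (hval i).abs
  have hμneg : ∀ x, μ (-x) = μ x := by
    intro x
    simp only [μ, w, polyValue_neg, abs_neg]
  have hμpos : ∀ x, ∑ j, |x j| = 1 → 0 < μ x := by
    intro x hx
    refine (Finset.lt_inf'_iff hne).2 fun S hS => ?_
    refine lt_of_le_of_ne (Finset.sum_nonneg fun i _ => abs_nonneg _) fun h0 => ?_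
    have hcard := (Finset.mem_powersetCard.1 hS).2
    have hzero := (Finset.sum_eq_zero_iff_of_nonneg fun i _ => abs_nonneg _).1 h0.symm
    have hx0 : x = 0 := by
      refine Matrix.eq_zero_of_forall_index_sum_mul_pow_eq_zero
        (f := fun j => (((S.orderEmbOfFin hcard j : Fin n) : ℕ) : ℝ)) ?_ fun j => ?_
      · intro a b hab
        exact (S.orderEmbOfFin hcard).injective (Fin.val_injective (Nat.cast_injective hab))
      · exact abs_eq_zero.1 (hzero _ (S.orderEmbOfFin_mem hcard j))
    simp [hx0] at hx
  refine ⟨fun x i => clampUnit ((d + 1) / μ x * polyValue x i), ?_, fun x hx => ⟨⟨?_, ?_⟩, ?_⟩⟩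
  · refine continuousOn_pi.2 fun i => continuous_clampUnit.comp_continuousOn ?_
    exact (continuousOn_const.div hμcont.continuousOn fun x hx => (hμpos x hx).ne').mul
      (hval i).continuousOn
  · exact fun i => abs_clampUnit_le _
  · set B : Finset (Fin n) :=
      Finset.univ.filter fun i => |clampUnit ((d + 1) / μ x * polyValue x i)| = 1 with hB
    have hncard : {i : Fin n | |clampUnit ((d + 1) / μ x * polyValue x i)| = 1}.ncard = B.card := by
      rw [← Set.ncard_coe_finset, hB]
      simp
    rw [hncard]
    by_contra! hlt
    have hcompl : d + 1 ≤ Bᶜ.card := by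
      rw [Finset.card_compl, Fintype.card_fin]
      omega
    obtain ⟨S, hSB, hS⟩ := Finset.exists_subset_card_eq hcompl
    have hle : μ x ≤ w S x := Finset.inf'_le _ (Finset.mem_powersetCard.2 ⟨Finset.subset_univ _, hS⟩)
    have hμ := hμpos x hx
    have hsum : w S x < ∑ _i ∈ S, μ x / (d + 1) := by
      refine Finset.sum_lt_sum_of_nonempty (Finset.card_pos.1 (by omega)) fun i hi => ?_
      have hi' : |clampUnit ((d + 1) / μ x * polyValue x i)| ≠ 1 := by
        simpa [hB] using hSB hi
      have := abs_lt_one_of_abs_clampUnit_ne hi'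
      rw [abs_mul, abs_of_pos (by positivity), div_mul_eq_mul_div, div_lt_one hμ] at this
      rw [lt_div_iff₀ (by positivity)]
      linarith
    rw [Finset.sum_const, hS, nsmul_eq_mul] at hsum
    push_cast at hsum
    rw [mul_div_cancel₀ _ (by positivity)] at hsum
    linarith
  · funext i
    simp only [hμneg, polyValue_neg, mul_neg, clampUnit_neg, Pi.neg_apply]

/-- A Borsuk--Ulam theorem on the skeleton `𝒞_d^n`: every continuous
`F : 𝒞_d^n → ℝ^d` identifies some antipodal pair, provided `1 ≤ d < n`. -/
theorem stmt9 (d n : ℕ) (hd : 1 ≤ d) (hdn : d < n)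
    (F : (Fin n → ℝ) → (Fin d → ℝ)) (hF : ContinuousOn F (cubeSkeleton n d)) :
    ∃ z ∈ cubeSkeleton n d, F z = F (-z) := by
  obtain ⟨g, hg, hgmem⟩ := exists_odd_map_to_cubeSkeleton hdn
  have hmaps : Set.MapsTo g {x | ∑ j, |x j| = 1} (cubeSkeleton n d) := fun x hx => (hgmem x hx).1
  have hneg : Set.MapsTo (fun x : Fin (d + 1) → ℝ => -x) {x | ∑ j, |x j| = 1}
      {x | ∑ j, |x j| = 1} := fun x hx => by simpa using hx
  have hFg := hF.comp hg hmaps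
  obtain ⟨x, hx, hx0⟩ := exists_eq_zero_of_odd_on_crossPolytope hd
    (fun x => F (g x) - F (g (-x))) (hFg.sub (hFg.comp continuous_neg.continuousOn hneg))
    (fun x _ => by simp)
  refine ⟨g x, (hgmem x hx).1, ?_⟩
  rw [← (hgmem x hx).2]
  exact sub_eq_zero.1 hx0
end
end

section
/- Fix n ∈ ℕ, a bias vector 𝛂 = (α_1,…,α_n) ∈ (0,1)^n, t > 0, and θ_1,…,θ_n ∈ ℝ. Let X be a real vector space and f : {-1,1}^n → X. Then for every x ∈ {-1,1}^n: Σ_{i=1}^n ∂_i^{α_i}(P_t^𝛂 f)(x) = Σ_{y ∈ {-1,1}^n} p_t^𝛂(x,y) · Σ_{i=1}^n η_t^{α_i}(x(i), y(i); θ_i) · ∂_i^{α_i} f(y). -/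
open Finset

noncomputable section

/-- Two sums over the cube agree if they agree on every edge in direction `i`. -/
lemma sum_cube_congr_of_update {ι X : Type*} [Fintype ι] [DecidableEq ι] [AddCommGroup X]
    [Module ℝ X] (i : ι) (G H : (ι → Bool) → X)
    (h : ∀ y, G (Function.update y i true) + G (Function.update y i false) =
      H (Function.update y i true) + H (Function.update y i false)) :
    ∑ y, G y = ∑ y, H y := by
  have flip_flip : Function.Involutive (fun y : ι → Bool => flipc y i) := fun y => by
    simp [flipc]
  have key : ∀ F : (ι → Bool) → X, (2 : ℝ) • ∑ y, F y =
      ∑ y, (F (Function.update y i true) + F (Function.update y i false)) := fun F => by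
    have hflip : ∑ y, F (flipc y i) = ∑ y, F y := Equiv.sum_comp flip_flip.toPerm F
    rw [two_smul]
    nth_rewrite 2 [← hflip]
    rw [← Finset.sum_add_distrib]
    refine Finset.sum_congr rfl fun y _ => ?_
    have hy : Function.update y i (y i) = y := Function.update_eq_self i y
    cases hi : y i <;> rw [hi] at hy <;> simp [flipc, hi, hy, add_comm]
  have h2 : (2 : ℝ) • ∑ y, G y = (2 : ℝ) • ∑ y, H y := by
    rw [key, key]
    exact Finset.sum_congr rfl fun y _ => h y
  have h3 := congrArg (fun v : X => (2 : ℝ)⁻¹ • v) h2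
  simpa [smul_smul] using h3

lemma pprod_eq_mul_prod_erase {n : ℕ} (t : ℝ) (a : Fin n → ℝ) (x y : Fin n → Bool) (i : Fin n) :
    pprod t a x y =
      ptrans t (a i) (x i) (y i) * ∏ j ∈ univ.erase i, ptrans t (a j) (x j) (y j) :=
  (Finset.mul_prod_erase univ (fun j => ptrans t (a j) (x j) (y j)) (mem_univ i)).symm

lemma prod_erase_update {n : ℕ} (t : ℝ) (a : Fin n → ℝ) (x y : Fin n → Bool) (i : Fin n)
    (b c : Bool) :
    ∏ j ∈ univ.erase i,
        ptrans t (a j) (Function.update x i b j) (Function.update y i c j) =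
      ∏ j ∈ univ.erase i, ptrans t (a j) (x j) (y j) :=
  Finset.prod_congr rfl fun j hj => by simp [Finset.ne_of_mem_erase hj]

lemma pprod_update {n : ℕ} (t : ℝ) (a : Fin n → ℝ) (x y : Fin n → Bool) (i : Fin n)
    (b c : Bool) :
    pprod t a (Function.update x i b) (Function.update y i c) =
      ptrans t (a i) b c * ∏ j ∈ univ.erase i, ptrans t (a j) (x j) (y j) := by
  rw [pprod_eq_mul_prod_erase t a _ _ i, prod_erase_update]
  simp

/-- The derivative in direction `i` of the biased heat flow, in terms of `η`. -/
lemma bder_heat_flow {n : ℕ} {X : Type*} [AddCommGroup X] [Module ℝ X] (a : Fin n → ℝ)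
    (i : Fin n) (ha : 0 < a i ∧ a i < 1) {t : ℝ} (ht : 0 < t) (θ : ℝ)
    (f : (Fin n → Bool) → X) (x : Fin n → Bool) :
    bder (a i) i (fun z => ∑ y, pprod t a z y • f y) x =
      ∑ y, pprod t a x y • eta t (a i) θ (x i) (y i) • bder (a i) i f y := by
  simp only [bder, Finset.smul_sum]
  rw [← Finset.sum_add_distrib, ← Finset.sum_sub_distrib]
  refine sum_cube_congr_of_update i _ _ fun y => ?_
  obtain ⟨h0, h1⟩ := ha
  have hE : 0 < Real.exp (-t) := Real.exp_pos _
  have hE1 : Real.exp (-t) < 1 := by rw [← Real.exp_zero]; exact Real.exp_lt_exp.mpr (by linarith)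
  have hx : ∀ c, pprod t a x (Function.update y i c) =
      ptrans t (a i) (x i) c * ∏ j ∈ univ.erase i, ptrans t (a j) (x j) (y j) := fun c => by
    simpa using pprod_update t a x y i (x i) c
  simp only [pprod_update, hx, Function.update_idem, Function.update_self]
  generalize ∏ j ∈ univ.erase i, ptrans t (a j) (x j) (y j) = K
  generalize f (Function.update y i true) = u
  generalize f (Function.update y i false) = v
  have htt : 1 - (1 - Real.exp (-t)) * (1 - a i) ≠ 0 := by nlinarith
  have hff : 1 - (1 - Real.exp (-t)) * a i ≠ 0 := by nlinarith
  have hE' : 1 - Real.exp (-t) ≠ 0 := by linarith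
  have ha' : 1 - a i ≠ 0 := by linarith
  cases x i <;> simp only [ptrans, eta] <;> match_scalars <;> field_simp <;> ring

/-- The biased heat-flow derivative identity: for the semigroup
`P_t^𝛂 f(x) = Σ_y p_t^𝛂(x,y) f(y)` one has
`Σ_i ∂_i^{α_i}(P_t^𝛂 f)(x) = Σ_y p_t^𝛂(x,y) Σ_i η_t^{α_i}(x(i),y(i);θ_i) ∂_i^{α_i} f(y)`. -/
theorem stmt10 (n : ℕ) (a : Fin n → ℝ) (ha : ∀ i, 0 < a i ∧ a i < 1)
    (t : ℝ) (ht : 0 < t) (θ : Fin n → ℝ)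
    (X : Type) [AddCommGroup X] [Module ℝ X]
    (f : (Fin n → Bool) → X) (x : Fin n → Bool) :
    ∑ i, bder (a i) i (fun z => ∑ y : Fin n → Bool, pprod t a z y • f y) x =
      ∑ y : Fin n → Bool, pprod t a x y •
        ∑ i, eta t (a i) (θ i) (x i) (y i) • bder (a i) i f y := by
  rw [Finset.sum_congr rfl fun i _ => bder_heat_flow a i (ha i) ht (θ i) f x, Finset.sum_comm]
  exact Finset.sum_congr rfl fun y _ => Finset.smul_sum.symm
end
end

section
/- Fix p ∈ [1,2] and let X be a real normed space having Rademacher type p with constant T. Then for every n ∈ ℕ, every bias vector 𝛂 = (α_1,…,α_n) ∈ (0,1)^n, and every function f : {-1,1}^n → X: ∫_{{-1,1}^n} ‖f(x) − ∫_{{-1,1}^n} f dμ_𝛂‖_X^p dμ_𝛂(x) ≤ (2π T)^p · Σ_{i=1}^n ∫_{{-1,1}^n} ‖∂_i^{α_i} f(x)‖_X^p dμ_𝛂(x). -/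
open Finset

noncomputable section

lemma flipc_involutive {ι : Type*} [DecidableEq ι] (i : ι) : Function.Involutive fun x : ι → Bool => flipc x i := by
  intro x
  simp [flipc]

section CubeSums

variable {ι : Type*} [Fintype ι] [DecidableEq ι]

lemma sum_prod_weight_eq_one (w : ι → Bool → ℝ) (hw : ∀ i, w i true + w i false = 1) :
    ∑ x : ι → Bool, ∏ i, w i (x i) = 1 := by
  have h := Finset.prod_univ_sum (fun _ : ι => (Finset.univ : Finset Bool)) w
  rw [Fintype.piFinset_univ] at h
  rw [← h]
  simp [hw]

lemma sum_prod_weight_mul_coord (w : ι → Bool → ℝ) (hw : ∀ i, w i true + w i false = 1)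
    (i : ι) (φ : Bool → ℝ) :
    ∑ x : ι → Bool, (∏ j, w j (x j)) * φ (x i) = w i true * φ true + w i false * φ false := by
  have h := Finset.prod_univ_sum (fun _ : ι => (Finset.univ : Finset Bool))
    (fun j b => w j b * if j = i then φ b else 1)
  rw [Fintype.piFinset_univ] at h
  simp only [Finset.prod_mul_distrib, Finset.prod_ite_eq', Finset.mem_univ, if_true] at h
  rw [← h, Finset.prod_eq_single i]
  · simp
  · intro j _ hj
    simp [hj, hw]
  · simp

/-- Sums over the cube agree as soon as they agree on every edge in direction `i`. -/
lemma sum_eq_sum_of_edge {X : Type*} [AddCommGroup X] [Module ℝ X] (i : ι)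
    (g₁ g₂ : (ι → Bool) → X)
    (h : ∀ y, g₁ y + g₁ (flipc y i) = g₂ y + g₂ (flipc y i)) : ∑ y, g₁ y = ∑ y, g₂ y := by
  have key : ∀ g : (ι → Bool) → X, ∑ y, (g y + g (flipc y i)) = (2 : ℝ) • ∑ y, g y := by
    intro g
    rw [Finset.sum_add_distrib, two_smul]
    congr 1
    exact Equiv.sum_comp (flipc_involutive i).toPerm g
  have := key g₁
  simp only [h] at this
  rw [key g₂] at this
  exact (smul_right_injective X (two_ne_zero (α := ℝ)) this).symm

end CubeSums

section Symmetrization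

variable {n : ℕ} {X : Type*} [NormedAddCommGroup X] [NormedSpace ℝ X]

/-- Jensen's inequality for the `p`-th power of the norm of a finite convex combination. -/
lemma norm_sum_smul_rpow_le {κ : Type*} [Fintype κ] {p : ℝ} (hp : 1 ≤ p) (w : κ → ℝ)
    (hw0 : ∀ k, 0 ≤ w k) (hw1 : ∑ k, w k = 1) (z : κ → X) :
    ‖∑ k, w k • z k‖ ^ p ≤ ∑ k, w k * ‖z k‖ ^ p := by
  have h1 : ‖∑ k, w k • z k‖ ≤ ∑ k, w k * ‖z k‖ :=
    (norm_sum_le _ _).trans_eq <| Finset.sum_congr rfl fun k _ => by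
      rw [norm_smul, Real.norm_of_nonneg (hw0 k)]
  refine (Real.rpow_le_rpow (norm_nonneg _) h1 (by linarith)).trans ?_
  exact Real.rpow_arith_mean_le_arith_mean_rpow _ _ _ (fun k _ => hw0 k) hw1
    (fun k _ => norm_nonneg _) hp

/-- Exchange of the coordinates of `q.1` and `q.2` at which `e` is `false`. -/
def swapCoords {ι : Type*} (e : ι → Bool) (q : (ι → Bool) × (ι → Bool)) :
    (ι → Bool) × (ι → Bool) :=
  (fun i => if e i then q.1 i else q.2 i, fun i => if e i then q.2 i else q.1 i)

lemma swapCoords_involutive {ι : Type*} (e : ι → Bool) :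
    Function.Involutive (swapCoords e) := by
  intro q
  ext i <;> by_cases h : e i <;> simp [swapCoords, h]

/-- Symmetrization: Rademacher type controls sums of independent differences. -/
lemma RademacherType.sum_differences_le {p T : ℝ} (htype : RademacherType X p T)
    (w : Fin n → Bool → ℝ) (hw0 : ∀ i b, 0 ≤ w i b) (c : Fin n → Bool → ℝ) (v : Fin n → X) :
    ∑ q : (Fin n → Bool) × (Fin n → Bool), ((∏ i, w i (q.1 i)) * ∏ i, w i (q.2 i)) *
        ‖∑ i, (c i (q.1 i) - c i (q.2 i)) • v i‖ ^ p ≤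
      T ^ p * ∑ q : (Fin n → Bool) × (Fin n → Bool),
        ((∏ i, w i (q.1 i)) * ∏ i, w i (q.2 i)) *
          ∑ i, ‖(c i (q.1 i) - c i (q.2 i)) • v i‖ ^ p := by
  set W : (Fin n → Bool) × (Fin n → Bool) → ℝ :=
    fun q => (∏ i, w i (q.1 i)) * ∏ i, w i (q.2 i) with hW
  have hW0 : ∀ q, 0 ≤ W q := fun q =>
    mul_nonneg (Finset.prod_nonneg fun i _ => hw0 _ _) (Finset.prod_nonneg fun i _ => hw0 _ _)
  have hswap : ∀ e : Fin n → Bool,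
      ∑ q, W q * ‖∑ i, (c i (q.1 i) - c i (q.2 i)) • v i‖ ^ p =
        ∑ q, W q * ‖∑ i, sgn (e i) • (c i (q.1 i) - c i (q.2 i)) • v i‖ ^ p := by
    intro e
    rw [← Equiv.sum_comp (swapCoords_involutive e).toPerm]
    refine Finset.sum_congr rfl fun q _ => ?_
    have hWq : W (swapCoords e q) = W q := by
      simp only [hW, swapCoords, ← Finset.prod_mul_distrib]
      refine Finset.prod_congr rfl fun i _ => ?_
      by_cases h : e i <;> simp [h, mul_comm]
    rw [Function.Involutive.coe_toPerm, hWq]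
    congr 3
    refine Finset.sum_congr rfl fun i _ => ?_
    rw [smul_smul]
    congr 1
    by_cases h : e i <;> simp [swapCoords, sgn, h]
  have havg : ∑ q, W q * ‖∑ i, (c i (q.1 i) - c i (q.2 i)) • v i‖ ^ p =
      ∑ q, W q * ((2 ^ n : ℝ)⁻¹ * ∑ e : Fin n → Bool,
        ‖∑ i, sgn (e i) • (c i (q.1 i) - c i (q.2 i)) • v i‖ ^ p) := by
    have hcard : ((2 : ℝ) ^ n)⁻¹ * ∑ _e : Fin n → Bool,
        ∑ q, W q * ‖∑ i, (c i (q.1 i) - c i (q.2 i)) • v i‖ ^ p =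
        ∑ q, W q * ‖∑ i, (c i (q.1 i) - c i (q.2 i)) • v i‖ ^ p := by
      rw [Finset.sum_const, Finset.card_univ, Fintype.card_fun, Fintype.card_bool,
        Fintype.card_fin, nsmul_eq_mul, ← mul_assoc]
      push_cast
      rw [inv_mul_cancel₀ (by positivity), one_mul]
    rw [← hcard, Finset.sum_congr rfl fun e _ => hswap e, Finset.sum_comm, Finset.mul_sum]
    refine Finset.sum_congr rfl fun q _ => ?_
    rw [← Finset.mul_sum]
    ring
  rw [havg, Finset.mul_sum]
  refine Finset.sum_le_sum fun q _ => ?_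
  calc _ ≤ W q * (T ^ p * ∑ i, ‖(c i (q.1 i) - c i (q.2 i)) • v i‖ ^ p) :=
        mul_le_mul_of_nonneg_left (htype n _) (hW0 q)
    _ = _ := by ring

/-- Rademacher type for sums of independent centered two-valued coefficients. -/
lemma RademacherType.sum_centered_le {p T : ℝ} (hp : 1 ≤ p) (htype : RademacherType X p T)
    (w : Fin n → Bool → ℝ) (hw0 : ∀ i b, 0 ≤ w i b) (hw1 : ∀ i, w i true + w i false = 1)
    (c : Fin n → Bool → ℝ) (hc : ∀ i, w i true * c i true + w i false * c i false = 0)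
    (v : Fin n → X) :
    ∑ x : Fin n → Bool, (∏ i, w i (x i)) * ‖∑ i, c i (x i) • v i‖ ^ p ≤
      T ^ p * ∑ i, 2 * (w i true * w i false) * |c i true - c i false| ^ p * ‖v i‖ ^ p := by
  have hp0 : p ≠ 0 := by linarith
  have hmean : ∑ y : Fin n → Bool, (∏ i, w i (y i)) • ∑ i, c i (y i) • v i = 0 := by
    simp_rw [Finset.smul_sum, smul_smul]
    rw [Finset.sum_comm]
    refine Finset.sum_eq_zero fun i _ => ?_
    rw [← Finset.sum_smul, sum_prod_weight_mul_coord w hw1 i, hc, zero_smul]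
  have hone := sum_prod_weight_eq_one w hw1
  have hW0 : ∀ x : Fin n → Bool, 0 ≤ ∏ i, w i (x i) := fun x =>
    Finset.prod_nonneg fun i _ => hw0 _ _
  calc ∑ x : Fin n → Bool, (∏ i, w i (x i)) * ‖∑ i, c i (x i) • v i‖ ^ p
      ≤ ∑ x : Fin n → Bool, (∏ i, w i (x i)) * ∑ y : Fin n → Bool, (∏ i, w i (y i)) *
          ‖∑ i, (c i (x i) - c i (y i)) • v i‖ ^ p := by
        refine Finset.sum_le_sum fun x _ => mul_le_mul_of_nonneg_left ?_ (hW0 x)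
        have hx : ∑ i, c i (x i) • v i = ∑ y : Fin n → Bool, (∏ i, w i (y i)) •
            ∑ i, (c i (x i) - c i (y i)) • v i := by
          simp_rw [sub_smul, Finset.sum_sub_distrib, smul_sub]
          rw [Finset.sum_sub_distrib, hmean, ← Finset.sum_smul, hone, one_smul, sub_zero]
        rw [hx]
        exact norm_sum_smul_rpow_le hp _ hW0 hone _
    _ = ∑ q : (Fin n → Bool) × (Fin n → Bool), ((∏ i, w i (q.1 i)) * ∏ i, w i (q.2 i)) *
        ‖∑ i, (c i (q.1 i) - c i (q.2 i)) • v i‖ ^ p := by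
        rw [Fintype.sum_prod_type]
        simp_rw [Finset.mul_sum, mul_assoc]
    _ ≤ _ := htype.sum_differences_le w hw0 c v
    _ = _ := by
        congr 1
        simp_rw [Finset.mul_sum]
        rw [Finset.sum_comm]
        refine Finset.sum_congr rfl fun i _ => ?_
        rw [Fintype.sum_prod_type]
        have h1 : ∀ x : Fin n → Bool, ∑ y : Fin n → Bool,
            (∏ j, w j (x j)) * (∏ j, w j (y j)) * ‖(c i (x i) - c i (y i)) • v i‖ ^ p =
            (∏ j, w j (x j)) * (w i true * ‖(c i (x i) - c i true) • v i‖ ^ p +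
              w i false * ‖(c i (x i) - c i false) • v i‖ ^ p) := by
          intro x
          simp_rw [mul_assoc]
          rw [← Finset.mul_sum, sum_prod_weight_mul_coord w hw1 i
            fun b => ‖(c i (x i) - c i b) • v i‖ ^ p]
        simp_rw [h1]
        rw [sum_prod_weight_mul_coord w hw1 i fun b =>
          (w i true * ‖(c i b - c i true) • v i‖ ^ p +
              w i false * ‖(c i b - c i false) • v i‖ ^ p)]
        simp only [norm_smul, Real.norm_eq_abs, Real.mul_rpow (abs_nonneg _) (norm_nonneg _),
          sub_self, abs_zero, zero_mul, mul_zero, Real.zero_rpow hp0,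
          zero_add, add_zero, abs_sub_comm (c i false) (c i true)]
        ring

end Symmetrization

section Kernel

/-- The mass that a coin of bias `α` gives to `b`. -/
def coinMass (α : ℝ) (b : Bool) : ℝ := if b then α else 1 - α

/-- Transition kernel: keep the coordinate with probability `s`, otherwise resample it. -/
def resampleKernel (s α : ℝ) (x y : Bool) : ℝ :=
  (if x = y then s else 0) + (1 - s) * coinMass α y

/-- The sum of the variances of the two rows of `resampleKernel`. -/
def rowVariance (s α : ℝ) : ℝ :=
  resampleKernel s α true true * resampleKernel s α true false +
    resampleKernel s α false true * resampleKernel s α false false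

/-- Coefficients representing the derivative of `resampleKernel` as an average of biased partial
derivatives; they are centered in `x` for the row of `y`. -/
def derivCoeff (s α : ℝ) (x y : Bool) : ℝ :=
  (if x then resampleKernel s α y false else -resampleKernel s α y true) *
    (if y then (rowVariance s α)⁻¹ else -(rowVariance s α)⁻¹)

lemma resampleKernel_row_sum (s α : ℝ) (x : Bool) :
    resampleKernel s α x true + resampleKernel s α x false = 1 := by
  cases x <;> simp [resampleKernel, coinMass] <;> ring

lemma coinMass_nonneg {α : ℝ} (h0 : 0 < α) (h1 : α < 1) (b : Bool) : 0 ≤ coinMass α b := by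
  cases b <;> simp [coinMass] <;> linarith

lemma resampleKernel_nonneg {s α : ℝ} (hs0 : 0 ≤ s) (hs1 : s ≤ 1) (h0 : 0 < α) (h1 : α < 1)
    (x y : Bool) : 0 ≤ resampleKernel s α x y := by
  have h := mul_nonneg (sub_nonneg.2 hs1) (coinMass_nonneg h0 h1 y)
  unfold resampleKernel
  split_ifs <;> linarith

lemma coinMass_mul_resampleKernel (s α : ℝ) (x y : Bool) :
    coinMass α x * resampleKernel s α x y = coinMass α y * resampleKernel s α y x := by
  cases x <;> cases y <;> simp [resampleKernel, coinMass] <;> ring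

lemma le_rowVariance (s : ℝ) {α : ℝ} (h0 : 0 < α) (h1 : α < 1) :
    s * (1 - s) ≤ rowVariance s α := by
  have h : 0 ≤ (1 - s) ^ 2 * (2 * (α * (1 - α))) := by
    have := sub_pos.2 h1
    positivity
  have e : rowVariance s α = s * (1 - s) + (1 - s) ^ 2 * (2 * (α * (1 - α))) := by
    simp [rowVariance, resampleKernel, coinMass]
    ring
  linarith

lemma derivCoeff_centered (s α : ℝ) (y : Bool) :
    resampleKernel s α y true * derivCoeff s α true y +
      resampleKernel s α y false * derivCoeff s α false y = 0 := by
  simp only [derivCoeff, if_true, Bool.false_eq_true, if_false]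
  ring

lemma sum_resampleKernel_derivCoeff {s α : ℝ} (h : rowVariance s α ≠ 0) (x : Bool) :
    resampleKernel s α x true * derivCoeff s α x true * (1 - α) -
      resampleKernel s α x false * derivCoeff s α x false * α = (if x then 1 else 0) - α := by
  have key : rowVariance s α * (rowVariance s α)⁻¹ = 1 := mul_inv_cancel₀ h
  simp only [derivCoeff, if_true, Bool.false_eq_true, if_false]
  generalize (rowVariance s α)⁻¹ = r at key ⊢
  simp only [rowVariance, resampleKernel, coinMass] at key ⊢
  cases x <;> simp at key ⊢
  · linear_combination (-α) * key
  · linear_combination (1 - α) * key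

lemma derivCoeff_moment_le {s α p : ℝ} (hp0 : 0 ≤ p) (hp2 : p ≤ 2) (hs0 : 0 < s) (hs1 : s < 1)
    (h0 : 0 < α) (h1 : α < 1) (y : Bool) :
    2 * (resampleKernel s α y true * resampleKernel s α y false) *
      |derivCoeff s α true y - derivCoeff s α false y| ^ p ≤ (2 / √(s * (1 - s))) ^ p := by
  set k := resampleKernel s α with hk
  set V := rowVariance s α with hV
  have hss : 0 < s * (1 - s) := mul_pos hs0 (sub_pos.2 hs1)
  have hVs : s * (1 - s) ≤ V := le_rowVariance s h0 h1
  have hVpos : 0 < V := hss.trans_le hVs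
  have hkn : ∀ x y, 0 ≤ k x y := resampleKernel_nonneg hs0.le hs1.le h0 h1
  have hrow : k y true + k y false = 1 := resampleKernel_row_sum s α y
  have hq0 : 0 ≤ k y true * k y false := mul_nonneg (hkn _ _) (hkn _ _)
  have hq1 : 2 * (k y true * k y false) ≤ 1 := by
    nlinarith [sq_nonneg (k y true - k y false), sq_nonneg (k y true), sq_nonneg (k y false)]
  have hqV : k y true * k y false ≤ V := by
    have h1 := mul_nonneg (hkn true true) (hkn true false)
    have h2 := mul_nonneg (hkn false true) (hkn false false)
    have h3 : V = k true true * k true false + k false true * k false false := rfl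
    cases y <;> linarith
  have hdiff : |derivCoeff s α true y - derivCoeff s α false y| = V⁻¹ := by
    have : derivCoeff s α true y - derivCoeff s α false y =
        (k y true + k y false) * (if y then V⁻¹ else -V⁻¹) := by
      simp only [derivCoeff, if_true, Bool.false_eq_true, if_false]
      ring
    rw [this, hrow, one_mul]
    cases y <;> simp [abs_of_pos hVpos]
  set q := 2 * (k y true * k y false) with hq
  have hq0' : 0 ≤ q := by positivity
  have hsqrt : √q * V⁻¹ ≤ 2 / √(s * (1 - s)) := by
    rw [← div_eq_mul_inv, div_le_div_iff₀ hVpos (Real.sqrt_pos.2 hss)]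
    rw [← Real.sqrt_mul hq0']
    apply Real.sqrt_le_iff.2
    constructor
    · positivity
    · nlinarith
  have hqp : q ≤ √q ^ p := by
    rw [Real.sqrt_eq_rpow, ← Real.rpow_mul hq0']
    rcases hq0'.eq_or_lt with h | h
    · rw [← h]
      positivity
    · calc q = q ^ (1 : ℝ) := (Real.rpow_one q).symm
        _ ≤ _ := Real.rpow_le_rpow_of_exponent_ge h hq1 (by linarith)
  rw [hdiff]
  calc q * V⁻¹ ^ p ≤ √q ^ p * V⁻¹ ^ p := by gcongr
    _ = (√q * V⁻¹) ^ p := (Real.mul_rpow (Real.sqrt_nonneg _) (by positivity)).symm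
    _ ≤ _ := Real.rpow_le_rpow (by positivity) hsqrt hp0

end Kernel

section NoiseOperator

variable {n : ℕ} {X : Type*} [NormedAddCommGroup X] [NormedSpace ℝ X]

/-- The operator resampling every coordinate independently with probability `1 - s`. -/
def noiseOp (a : Fin n → ℝ) (f : (Fin n → Bool) → X) (s : ℝ) (x : Fin n → Bool) : X :=
  ∑ y, (∏ i, resampleKernel s (a i) (x i) (y i)) • f y

/-- The derivative of `noiseOp` in the parameter `s`. -/
def noiseOpDeriv (a : Fin n → ℝ) (f : (Fin n → Bool) → X) (s : ℝ) (x : Fin n → Bool) : X :=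
  ∑ y, (∑ i, (∏ j ∈ univ.erase i, resampleKernel s (a j) (x j) (y j)) *
    ((if x i = y i then 1 else 0) - coinMass (a i) (y i))) • f y

lemma hasDerivAt_noiseOp (a : Fin n → ℝ) (f : (Fin n → Bool) → X) (s : ℝ) (x : Fin n → Bool) :
    HasDerivAt (fun s => noiseOp a f s x) (noiseOpDeriv a f s x) s := by
  refine HasDerivAt.fun_sum fun y _ => HasDerivAt.smul_const ?_ (f y)
  have h : ∀ i ∈ (univ : Finset (Fin n)), HasDerivAt
      (fun s => resampleKernel s (a i) (x i) (y i))
      ((if x i = y i then 1 else 0) - coinMass (a i) (y i)) s := by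
    intro i _
    have h1 : HasDerivAt (fun s : ℝ => if x i = y i then s else 0)
        (if x i = y i then 1 else 0) s := by
      split_ifs
      · exact hasDerivAt_id s
      · exact hasDerivAt_const s 0
    have h2 := h1.add (((hasDerivAt_id s).const_sub 1).mul_const (coinMass (a i) (y i)))
    convert! h2 using 1
    ring
  simpa only [smul_eq_mul] using HasDerivAt.fun_finsetProd h

lemma noiseOp_zero (a : Fin n → ℝ) (f : (Fin n → Bool) → X) (x : Fin n → Bool) :
    noiseOp a f 0 x = ∑ y, biasedWeight a y • f y := by
  refine Finset.sum_congr rfl fun y _ => ?_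
  simp [resampleKernel, biasedWeight, coinMass]

lemma noiseOp_one (a : Fin n → ℝ) (f : (Fin n → Bool) → X) (x : Fin n → Bool) :
    noiseOp a f 1 x = f x := by
  have h : ∀ y : Fin n → Bool,
      ∏ i, resampleKernel 1 (a i) (x i) (y i) = if x = y then 1 else 0 := by
    intro y
    simp only [resampleKernel, sub_self, zero_mul, add_zero, Fintype.prod_ite_zero,
      Finset.prod_const_one, funext_iff]
  simp [noiseOp, h, ite_smul]

lemma bder_flipc_eq (α : ℝ) (i : Fin n) (f : (Fin n → Bool) → X) (y : Fin n → Bool)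
    (hy : y i = true) :
    bder α i f y = (1 - α) • (f y - f (flipc y i)) ∧
      bder α i f (flipc y i) = -α • (f y - f (flipc y i)) := by
  have ht : Function.update y i true = y := by rw [← hy, Function.update_eq_self]
  have hf : flipc y i = Function.update y i false := by rw [flipc, hy, Bool.not_true]
  simp only [bder, hf, Function.update_idem, ht]
  constructor <;> module

lemma noiseOpDeriv_eq (a : Fin n → ℝ) (f : (Fin n → Bool) → X) {s : ℝ}
    (hV : ∀ i, rowVariance s (a i) ≠ 0) (x : Fin n → Bool) :
    noiseOpDeriv a f s x = ∑ y, (∏ i, resampleKernel s (a i) (x i) (y i)) •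
      ∑ i, derivCoeff s (a i) (x i) (y i) • bder (a i) i f y := by
  simp only [noiseOpDeriv, Finset.sum_smul, Finset.smul_sum]
  rw [Finset.sum_comm, Finset.sum_comm (s := univ) (t := univ) (f := fun y i =>
    (∏ i, resampleKernel s (a i) (x i) (y i)) • derivCoeff s (a i) (x i) (y i) • bder (a i) i f y)]
  refine Finset.sum_congr rfl fun i _ => ?_
  simp only [← Finset.mul_prod_erase univ _ (Finset.mem_univ i)]
  have edge : ∀ y : Fin n → Bool, y i = true → ∀ c : ℝ,
      (c * ((if x i = true then 1 else 0) - coinMass (a i) true)) • f y +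
        (c * ((if x i = false then 1 else 0) - coinMass (a i) false)) • f (flipc y i) =
      (resampleKernel s (a i) (x i) true * c) • derivCoeff s (a i) (x i) true • bder (a i) i f y +
        (resampleKernel s (a i) (x i) false * c) • derivCoeff s (a i) (x i) false •
          bder (a i) i f (flipc y i) := by
    intro y hy c
    obtain ⟨h1, h2⟩ := bder_flipc_eq (a i) i f y hy
    rw [h1, h2]
    have h3 := sum_resampleKernel_derivCoeff (hV i) (x i)
    calc _ = (c * ((if x i then 1 else 0) - a i)) • (f y - f (flipc y i)) := by
          cases x i <;> simp [coinMass] <;> module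
      _ = _ := by
          rw [← h3]
          module
  have herase : ∀ y : Fin n → Bool,
      ∏ j ∈ univ.erase i, resampleKernel s (a j) (x j) (flipc y i j) =
        ∏ j ∈ univ.erase i, resampleKernel s (a j) (x j) (y j) := by
    intro y
    refine Finset.prod_congr rfl fun j hj => ?_
    rw [flipc, Function.update_of_ne (Finset.ne_of_mem_erase hj)]
  refine sum_eq_sum_of_edge i _ _ fun y => ?_
  rw [herase y]
  set c := ∏ j ∈ univ.erase i, resampleKernel s (a j) (x j) (y j)
  cases hy : y i
  · have hz : flipc y i i = true := by simp [flipc, hy]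
    have h := edge (flipc y i) hz c
    rw [show flipc (flipc y i) i = y from flipc_involutive i y] at h
    rw [hz, add_comm, h, add_comm]
  · have hz : flipc y i i = false := by simp [flipc, hy]
    rw [hz]
    exact edge y hy c

lemma biasedWeight_mul_kernel (a : Fin n → ℝ) (s : ℝ) (x y : Fin n → Bool) :
    biasedWeight a x * ∏ i, resampleKernel s (a i) (x i) (y i) =
      biasedWeight a y * ∏ i, resampleKernel s (a i) (y i) (x i) := by
  rw [biasedWeight, biasedWeight, ← Finset.prod_mul_distrib, ← Finset.prod_mul_distrib]
  exact Finset.prod_congr rfl fun i _ => coinMass_mul_resampleKernel s (a i) (x i) (y i)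

lemma biasedWeight_nonneg {a : Fin n → ℝ} (ha : ∀ i, 0 < a i ∧ a i < 1) (x : Fin n → Bool) :
    0 ≤ biasedWeight a x :=
  Finset.prod_nonneg fun i _ => coinMass_nonneg (ha i).1 (ha i).2 (x i)

/-- The `L_p` bound on the derivative of the noise operator. -/
lemma RademacherType.sum_noiseOpDeriv_le {p T : ℝ} (hp1 : 1 ≤ p) (hp2 : p ≤ 2) (hT : 0 < T)
    (htype : RademacherType X p T) {a : Fin n → ℝ} (ha : ∀ i, 0 < a i ∧ a i < 1)
    (f : (Fin n → Bool) → X) {s : ℝ} (hs0 : 0 < s) (hs1 : s < 1) :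
    ∑ x, biasedWeight a x * ‖noiseOpDeriv a f s x‖ ^ p ≤
      (2 * T / √(s * (1 - s))) ^ p *
        ∑ i, ∑ x, biasedWeight a x * ‖bder (a i) i f x‖ ^ p := by
  have hV : ∀ i, rowVariance s (a i) ≠ 0 := fun i =>
    ((mul_pos hs0 (sub_pos.2 hs1)).trans_le (le_rowVariance s (ha i).1 (ha i).2)).ne'
  have hk0 : ∀ i x y, 0 ≤ resampleKernel s (a i) x y := fun i =>
    resampleKernel_nonneg hs0.le hs1.le (ha i).1 (ha i).2
  have hμ := biasedWeight_nonneg ha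
  set g : (Fin n → Bool) → (Fin n → Bool) → X := fun x y =>
    ∑ i, derivCoeff s (a i) (x i) (y i) • bder (a i) i f y with hg
  calc ∑ x, biasedWeight a x * ‖noiseOpDeriv a f s x‖ ^ p
      ≤ ∑ x, biasedWeight a x *
          ∑ y, (∏ i, resampleKernel s (a i) (x i) (y i)) * ‖g x y‖ ^ p := by
        refine Finset.sum_le_sum fun x _ => mul_le_mul_of_nonneg_left ?_ (hμ x)
        rw [noiseOpDeriv_eq a f hV x]
        exact norm_sum_smul_rpow_le hp1 _ (fun y => Finset.prod_nonneg fun i _ => hk0 i _ _)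
          (sum_prod_weight_eq_one (fun i => resampleKernel s (a i) (x i))
            fun i => resampleKernel_row_sum _ _ _) _
    _ = ∑ y, biasedWeight a y *
          ∑ x : Fin n → Bool, (∏ i, resampleKernel s (a i) (y i) (x i)) * ‖g x y‖ ^ p := by
        simp_rw [Finset.mul_sum]
        rw [Finset.sum_comm]
        refine Finset.sum_congr rfl fun y _ => Finset.sum_congr rfl fun x _ => ?_
        rw [← mul_assoc, biasedWeight_mul_kernel, mul_assoc]
    _ ≤ ∑ y, biasedWeight a y *
          (T ^ p * ∑ i, (2 / √(s * (1 - s))) ^ p * ‖bder (a i) i f y‖ ^ p) := by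
        refine Finset.sum_le_sum fun y _ => mul_le_mul_of_nonneg_left ?_ (hμ y)
        refine (htype.sum_centered_le hp1 (fun i => resampleKernel s (a i) (y i))
          (fun i b => hk0 i _ _) (fun i => resampleKernel_row_sum _ _ _)
          (fun i b => derivCoeff s (a i) b (y i)) (fun i => derivCoeff_centered _ _ _)
          (fun i => bder (a i) i f y)).trans ?_
        refine mul_le_mul_of_nonneg_left (Finset.sum_le_sum fun i _ => ?_) (by positivity)
        exact mul_le_mul_of_nonneg_right
          (derivCoeff_moment_le (by linarith) hp2 hs0 hs1 (ha i).1 (ha i).2 (y i)) (by positivity)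
    _ = _ := by
        rw [show 2 * T / √(s * (1 - s)) = T * (2 / √(s * (1 - s))) by ring,
          Real.mul_rpow hT.le (by positivity), Finset.sum_comm]
        simp_rw [Finset.mul_sum]
        refine Finset.sum_congr rfl fun y _ => Finset.sum_congr rfl fun i _ => ?_
        ring

end NoiseOperator

section MeanValue

/-- The mean value inequality in a finite weighted `L_p` space of vector-valued functions. -/
lemma sum_weight_norm_sub_rpow_le {κ X : Type*} [Fintype κ] [NormedAddCommGroup X]
    [NormedSpace ℝ X] {p : ℝ} (hp : 1 ≤ p) {w : κ → ℝ} (hw : ∀ x, 0 ≤ w x)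
    {g g' : ℝ → κ → X} {a b C : ℝ} (hab : a ≤ b) (hC : 0 ≤ C)
    (hderiv : ∀ t x, HasDerivAt (fun t => g t x) (g' t x) t)
    (hbound : ∀ t ∈ Set.Ico a b, ∑ x, w x * ‖g' t x‖ ^ p ≤ C ^ p) :
    ∑ x, w x * ‖g b x - g a x‖ ^ p ≤ (C * (b - a)) ^ p := by
  have hp0 : 0 < p := by linarith
  have : Fact (1 ≤ ENNReal.ofReal p) := ⟨by simpa using hp⟩
  have hq : (ENNReal.ofReal p).toReal = p := ENNReal.toReal_ofReal hp0.le
  let emb : (κ → X) → PiLp (ENNReal.ofReal p) fun _ : κ => X := fun h =>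
    WithLp.toLp _ fun x => w x ^ (1 / p) • h x
  have hsum0 : ∀ h : κ → X, 0 ≤ ∑ x, w x * ‖h x‖ ^ p := fun h =>
    Finset.sum_nonneg fun x _ => mul_nonneg (hw x) (by positivity)
  have hnorm : ∀ h, ‖emb h‖ ^ p = ∑ x, w x * ‖h x‖ ^ p := by
    intro h
    have hterm : ∀ x, ‖emb h x‖ ^ p = w x * ‖h x‖ ^ p := by
      intro x
      change ‖w x ^ (1 / p) • h x‖ ^ p = _
      rw [norm_smul, Real.norm_of_nonneg (Real.rpow_nonneg (hw x) _),
        Real.mul_rpow (Real.rpow_nonneg (hw x) _) (norm_nonneg _), ← Real.rpow_mul (hw x),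
        one_div_mul_cancel hp0.ne', Real.rpow_one]
    rw [PiLp.norm_eq_sum (by rwa [hq]), hq]
    simp_rw [hterm]
    rw [← Real.rpow_mul (hsum0 h), one_div_mul_cancel hp0.ne', Real.rpow_one]
  have hemb : ∀ t, HasDerivAt (fun t => emb (g t)) (emb (g' t)) t := by
    intro t
    rw [hasDerivAt_iff_hasFDerivAt, ← hasFDerivWithinAt_univ, hasFDerivWithinAt_piLp]
    intro x
    rw [hasFDerivWithinAt_univ]
    convert! ((hderiv t x).const_smul (w x ^ (1 / p))).hasFDerivAt using 1
  have hmvt := norm_image_sub_le_of_norm_deriv_le_segment'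
    (fun t _ => (hemb t).hasDerivWithinAt) (C := C)
    (fun t ht => (Real.rpow_le_rpow_iff (norm_nonneg _) hC hp0).1 (by
      rw [hnorm]; exact hbound t ht)) b (Set.right_mem_Icc.2 hab)
  have hdiff : emb (g b) - emb (g a) = emb fun x => g b x - g a x := by
    ext x
    exact (smul_sub _ _ _).symm
  rw [hdiff] at hmvt
  rw [← hnorm]
  exact Real.rpow_le_rpow (norm_nonneg _) hmvt hp0.le

end MeanValue

/-- The biased Poincaré inequality for normed spaces of Rademacher
type `p` with constant `T`, with constant `(2πT)^p`. -/
theorem stmt11 (p : ℝ) (hp1 : 1 ≤ p) (hp2 : p ≤ 2)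
    (X : Type) [NormedAddCommGroup X] [NormedSpace ℝ X]
    (T : ℝ) (hT : 0 < T) (htype : RademacherType X p T)
    (n : ℕ) (a : Fin n → ℝ) (ha : ∀ i, 0 < a i ∧ a i < 1)
    (f : (Fin n → Bool) → X) :
    ∑ x : Fin n → Bool, biasedWeight a x *
        ‖f x - ∑ y : Fin n → Bool, biasedWeight a y • f y‖ ^ p ≤
      (2 * Real.pi * T) ^ p *
        ∑ i, ∑ x : Fin n → Bool, biasedWeight a x * ‖bder (a i) i f x‖ ^ p := by
  set G : ℝ := ∑ i, ∑ x : Fin n → Bool, biasedWeight a x * ‖bder (a i) i f x‖ ^ p with hG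
  have hp0 : 0 < p := by linarith
  have hμ := biasedWeight_nonneg ha
  have hG0 : 0 ≤ G := Finset.sum_nonneg fun i _ => Finset.sum_nonneg fun x _ =>
    mul_nonneg (hμ x) (by positivity)
  have hGp : (G ^ (1 / p)) ^ p = G := by
    rw [← Real.rpow_mul hG0, one_div_mul_cancel hp0.ne', Real.rpow_one]
  have hderiv : ∀ (φ : ℝ) (x : Fin n → Bool),
      HasDerivAt (fun φ => noiseOp a f (Real.sin φ ^ 2) x)
        ((2 * Real.sin φ * Real.cos φ) • noiseOpDeriv a f (Real.sin φ ^ 2) x) φ := by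
    intro φ x
    have h1 : HasDerivAt (fun φ => Real.sin φ ^ 2) (2 * Real.sin φ * Real.cos φ) φ := by
      simpa using (Real.hasDerivAt_sin φ).fun_pow 2
    exact (hasDerivAt_noiseOp a f (Real.sin φ ^ 2) x).scomp φ h1
  have hbound : ∀ φ ∈ Set.Ico 0 (Real.pi / 2), ∑ x, biasedWeight a x *
      ‖(2 * Real.sin φ * Real.cos φ) • noiseOpDeriv a f (Real.sin φ ^ 2) x‖ ^ p ≤
        (4 * T * G ^ (1 / p)) ^ p := by
    intro φ hφ
    rcases hφ.1.eq_or_lt with h | h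
    · simp only [← h, Real.sin_zero, mul_zero, zero_mul, zero_smul, norm_zero,
        Real.zero_rpow hp0.ne', Finset.sum_const_zero]
      positivity
    have hsin : 0 < Real.sin φ := Real.sin_pos_of_pos_of_lt_pi h (by linarith [hφ.2, Real.pi_pos])
    have hcos : 0 < Real.cos φ :=
      Real.cos_pos_of_mem_Ioo ⟨by linarith [Real.pi_pos], hφ.2⟩
    have hs1 : Real.sin φ ^ 2 < 1 := by nlinarith [Real.sin_sq_add_cos_sq φ]
    have hsqrt : √(Real.sin φ ^ 2 * (1 - Real.sin φ ^ 2)) = Real.sin φ * Real.cos φ := by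
      rw [← Real.cos_sq', ← mul_pow]
      exact Real.sqrt_sq (by positivity)
    have hmain := htype.sum_noiseOpDeriv_le hp1 hp2 hT ha f (by positivity) hs1
    rw [hsqrt, ← hG] at hmain
    have hc : 0 ≤ 2 * Real.sin φ * Real.cos φ := by positivity
    calc _ = (2 * Real.sin φ * Real.cos φ) ^ p *
          ∑ x, biasedWeight a x * ‖noiseOpDeriv a f (Real.sin φ ^ 2) x‖ ^ p := by
          rw [Finset.mul_sum]
          refine Finset.sum_congr rfl fun x _ => ?_
          rw [norm_smul, Real.norm_of_nonneg hc, Real.mul_rpow hc (norm_nonneg _)]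
          ring
      _ ≤ (2 * Real.sin φ * Real.cos φ) ^ p * ((2 * T / (Real.sin φ * Real.cos φ)) ^ p * G) :=
          mul_le_mul_of_nonneg_left hmain (Real.rpow_nonneg hc p)
      _ = (4 * T) ^ p * G := by
          rw [← mul_assoc, ← Real.mul_rpow hc (by positivity)]
          congr 2
          field_simp
          ring
      _ = _ := by
          rw [Real.mul_rpow (by positivity) (Real.rpow_nonneg hG0 _), hGp]
  have hmvt := sum_weight_norm_sub_rpow_le hp1 hμ (by positivity)
    (mul_nonneg (by positivity) (Real.rpow_nonneg hG0 _)) hderiv hbound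
  simp only [Real.sin_pi_div_two, Real.sin_zero, one_pow, ne_eq, OfNat.ofNat_ne_zero,
    not_false_eq_true, zero_pow, noiseOp_one, noiseOp_zero] at hmvt
  refine hmvt.trans_eq ?_
  rw [show 4 * T * G ^ (1 / p) * (Real.pi / 2 - 0) = 2 * Real.pi * T * G ^ (1 / p) by ring,
    Real.mul_rpow (by positivity) (Real.rpow_nonneg hG0 _), hGp]
end
end

section
/- For every p ∈ [1,∞), α ∈ (0,1), q ∈ [2,∞) and C_q ∈ (0,∞) there exists a constant K ∈ (0,∞), depending only on p, α, q, C_q, such that for every real normed space X having cotype q with constant C_q, every n ∈ ℕ, and every function f : {-1,1}^n → X: ‖f − ∫_{{-1,1}^n} f dμ_α^n‖_{L_p(μ_α^n;X)} ≤ K · ( ∫_{{-1,1}^n} ‖Σ_{i=1}^n δ_i ∂_i^α f‖_{L_p(μ_α^n;X)}^p dσ_n(δ) )^{1/p}. -/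
open Finset

noncomputable section

theorem sum_fin_succ_arrow {B R : Type*} [Fintype B] [AddCommMonoid R] {n : ℕ}
    (F : (Fin (n + 1) → B) → R) :
    ∑ x, F x = ∑ b : B, ∑ x : Fin n → B, F (Fin.cons b x) := by
  rw [← Fintype.sum_prod_type']
  exact (Fintype.sum_equiv (Fin.consEquiv fun _ : Fin (n + 1) => B) _ _ fun _ => rfl).symm

theorem sum_prod_weight {A : Type*} [Fintype A] {n : ℕ} (w : Fin n → A → ℝ) :
    ∑ x : Fin n → A, ∏ i, w i (x i) = ∏ i, ∑ a, w i a := by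
  classical
  simpa using (Fintype.prod_sum w).symm

/-- Coordinatewise comparison of moments of sums of independent variables. -/
theorem sum_prod_weight_mul_norm_pow_le {A B X : Type*} [Fintype A] [Fintype B]
    [NormedAddCommGroup X] [NormedSpace ℝ X] (r : ℕ) (u h : B → ℝ) (hu : ∀ b, 0 ≤ u b) {n : ℕ}
    (w η : Fin n → A → ℝ) (hw : ∀ i a, 0 ≤ w i a)
    (H : ∀ i (z v : X), ∑ a, w i a * ‖z + η i a • v‖ ^ r ≤ ∑ b, u b * ‖z + h b • v‖ ^ r)
    (v : Fin n → X) (z : X) :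
    ∑ x : Fin n → A, (∏ i, w i (x i)) * ‖z + ∑ i, η i (x i) • v i‖ ^ r ≤
      ∑ y : Fin n → B, (∏ i, u (y i)) * ‖z + ∑ i, h (y i) • v i‖ ^ r := by
  induction n generalizing z with
  | zero => simp
  | succ n ih =>
    simp only [sum_fin_succ_arrow, Fin.prod_univ_succ, Fin.sum_univ_succ, Fin.cons_zero,
      Fin.cons_succ, mul_assoc, ← Finset.mul_sum, ← add_assoc]
    calc _ ≤ ∑ a, w 0 a * ∑ y : Fin n → B, (∏ i, u (y i)) *
            ‖z + η 0 a • v 0 + ∑ i, h (y i) • v i.succ‖ ^ r := by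
          gcongr with a
          · exact hw 0 a
          · exact ih (fun i => w i.succ) (fun i => η i.succ) (fun i => hw i.succ)
              (fun i => H i.succ) (fun i => v i.succ) _
      _ = ∑ y : Fin n → B, (∏ i, u (y i)) *
            ∑ a, w 0 a * ‖(z + ∑ i, h (y i) • v i.succ) + η 0 a • v 0‖ ^ r := by
          simp only [Finset.mul_sum]
          rw [Finset.sum_comm]
          refine Finset.sum_congr rfl fun y _ => Finset.sum_congr rfl fun a _ => ?_
          rw [add_right_comm]
          ring
      _ ≤ ∑ y : Fin n → B, (∏ i, u (y i)) *
            ∑ b, u b * ‖(z + ∑ i, h (y i) • v i.succ) + h b • v 0‖ ^ r := by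
          gcongr with y
          · exact Finset.prod_nonneg fun i _ => hu _
          · exact H 0 _ _
      _ = _ := by
          simp only [Finset.mul_sum]
          rw [Finset.sum_comm]
          refine Finset.sum_congr rfl fun y _ => Finset.sum_congr rfl fun a _ => ?_
          rw [add_right_comm]
          ring

theorem half_add_pow_add_sub_pow_le {c e x τ : ℝ} (hc : 0 ≤ c) (he : 0 ≤ e) (hτ : 0 ≤ τ)
    (hx : x ^ 2 ≤ τ * c * e) (k : ℕ) (hk : k * τ ≤ 1) :
    ((c + x) ^ k + (c - x) ^ k) / 2 ≤ (c + e) ^ k := by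
  have key : ∀ j : ℕ, j ≤ k → ((c + x) ^ j + (c - x) ^ j) / 2 ≤ (c + e) ^ j ∧
      x * (((c + x) ^ j - (c - x) ^ j) / 2) ≤ j * τ * e * (c + e) ^ j := by
    intro j
    induction j with
    | zero => simp
    | succ j ih =>
      intro hj
      obtain ⟨h1, h2⟩ := ih (by omega)
      have hP : 0 ≤ (c + e) ^ j := by positivity
      have hjτ : (j : ℝ) * τ ≤ 1 :=
        le_trans (by gcongr; omega) hk
      constructor
      · have h3 : (j : ℝ) * τ * (e * (c + e) ^ j) ≤ 1 * (e * (c + e) ^ j) := by gcongr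
        have h4 := mul_le_mul_of_nonneg_left h1 hc
        calc _ = c * (((c + x) ^ j + (c - x) ^ j) / 2) +
              x * (((c + x) ^ j - (c - x) ^ j) / 2) := by ring
          _ ≤ c * (c + e) ^ j + e * (c + e) ^ j := by linarith
          _ = _ := by ring
      · have h3 := mul_le_mul_of_nonneg_left h1 (sq_nonneg x)
        have h4 := mul_le_mul_of_nonneg_right hx hP
        have h5 := mul_le_mul_of_nonneg_left h2 hc
        have h6 : 0 ≤ ((j : ℝ) + 1) * τ * e * e * (c + e) ^ j := by positivity
        push_cast
        calc _ = c * (x * (((c + x) ^ j - (c - x) ^ j) / 2)) +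
              x ^ 2 * (((c + x) ^ j + (c - x) ^ j) / 2) := by ring
          _ ≤ c * (j * τ * e * (c + e) ^ j) + τ * c * e * (c + e) ^ j +
              ((j : ℝ) + 1) * τ * e * e * (c + e) ^ j := by linarith
          _ = _ := by ring
  exact (key k le_rfl).1

/-- The two-point hypercontractive inequality. -/
theorem two_point_norm_pow_le {X : Type*} [NormedAddCommGroup X] [NormedSpace ℝ X] {k : ℕ}
    {ρ : ℝ} (hρ0 : 0 ≤ ρ) (hρ1 : 2 * ρ ^ 2 ≤ 1) (hk : k * (8 * ρ ^ 2) ≤ 1) (a b : X) :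
    (‖a + ρ • b‖ ^ (2 * k) + ‖a - ρ • b‖ ^ (2 * k)) / 2 ≤
      ((‖a + b‖ ^ 2 + ‖a - b‖ ^ 2) / 2) ^ k := by
  set u := ‖a + b‖
  set w := ‖a - b‖
  have hu : 0 ≤ u := norm_nonneg _
  have hw : 0 ≤ w := norm_nonneg _
  have hρ : ρ ≤ 1 := by nlinarith
  have h1 : ‖a + ρ • b‖ ≤ (u + w) / 2 + ρ * ((u - w) / 2) := by
    calc ‖a + ρ • b‖ = ‖((1 + ρ) / 2) • (a + b) + ((1 - ρ) / 2) • (a - b)‖ := by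
          congr 1; module
      _ ≤ ((1 + ρ) / 2) * u + ((1 - ρ) / 2) * w := by
          refine (norm_add_le _ _).trans_eq ?_
          rw [norm_smul_of_nonneg (by linarith), norm_smul_of_nonneg (by linarith)]
      _ = _ := by ring
  have h2 : ‖a - ρ • b‖ ≤ (u + w) / 2 - ρ * ((u - w) / 2) := by
    calc ‖a - ρ • b‖ = ‖((1 - ρ) / 2) • (a + b) + ((1 + ρ) / 2) • (a - b)‖ := by
          congr 1; module
      _ ≤ ((1 - ρ) / 2) * u + ((1 + ρ) / 2) * w := by
          refine (norm_add_le _ _).trans_eq ?_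
          rw [norm_smul_of_nonneg (by linarith), norm_smul_of_nonneg (by linarith)]
      _ = _ := by ring
  generalize hA : (u + w) / 2 = A at *
  generalize hB : (u - w) / 2 = B at *
  have hAB : (u ^ 2 + w ^ 2) / 2 = (A ^ 2 + ρ ^ 2 * B ^ 2) + (1 - ρ ^ 2) * B ^ 2 := by
    rw [← hA, ← hB]; ring
  rw [hAB]
  refine le_trans ?_ (half_add_pow_add_sub_pow_le (x := 2 * ρ * A * B) (τ := 8 * ρ ^ 2)
    (by positivity) (mul_nonneg (by linarith [sq_nonneg ρ]) (sq_nonneg _)) (by positivity) ?_ k hk)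
  · have e1 : A ^ 2 + ρ ^ 2 * B ^ 2 + 2 * ρ * A * B = (A + ρ * B) ^ 2 := by ring
    have e2 : A ^ 2 + ρ ^ 2 * B ^ 2 - 2 * ρ * A * B = (A - ρ * B) ^ 2 := by ring
    rw [e1, e2, ← pow_mul, ← pow_mul]
    gcongr
  · have h3 : (1 : ℝ) / 2 ≤ 1 - ρ ^ 2 := by linarith
    calc (2 * ρ * A * B) ^ 2 = 8 * ρ ^ 2 * A ^ 2 * (1 / 2 * B ^ 2) := by ring
      _ ≤ 8 * ρ ^ 2 * (A ^ 2 + ρ ^ 2 * B ^ 2) * ((1 - ρ ^ 2) * B ^ 2) := by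
        gcongr
        nlinarith [mul_nonneg (sq_nonneg ρ) (sq_nonneg B)]

/-- Minkowski's inequality for weighted finite sums and natural exponents. -/
theorem sum_mul_add_pow_le {ι : Type*} (s : Finset ι) {w f g : ι → ℝ} {F G : ℝ} {k : ℕ}
    (hw : ∀ i, 0 ≤ w i) (hf : ∀ i, 0 ≤ f i) (hg : ∀ i, 0 ≤ g i) (hF : 0 ≤ F) (hG : 0 ≤ G)
    (hk : k ≠ 0) (hfF : ∑ i ∈ s, w i * f i ^ k ≤ F ^ k) (hgG : ∑ i ∈ s, w i * g i ^ k ≤ G ^ k) :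
    ∑ i ∈ s, w i * (f i + g i) ^ k ≤ (F + G) ^ k := by
  have zero : ∀ {f : ι → ℝ}, (∀ i, 0 ≤ f i) → ∑ i ∈ s, w i * f i ^ k ≤ 0 ^ k →
      ∀ i ∈ s, w i = 0 ∨ f i = 0 := by
    intro f hf h i hi
    rw [zero_pow hk] at h
    have h0 : ∀ i ∈ s, 0 ≤ w i * f i ^ k := fun i _ => mul_nonneg (hw i) (pow_nonneg (hf i) k)
    have := (Finset.sum_eq_zero_iff_of_nonneg h0).1 (le_antisymm h (Finset.sum_nonneg h0)) i hi
    simpa [hk] using this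
  rcases hF.eq_or_lt with rfl | hF
  · rw [zero_add]
    refine le_trans (le_of_eq (Finset.sum_congr rfl fun i hi => ?_)) hgG
    rcases zero hf hfF i hi with h | h <;> simp [h]
  rcases hG.eq_or_lt with rfl | hG
  · rw [add_zero]
    refine le_trans (le_of_eq (Finset.sum_congr rfl fun i hi => ?_)) hfF
    rcases zero hg hgG i hi with h | h <;> simp [h]
  have hpt : ∀ i ∈ s, w i * (f i + g i) ^ k ≤ (F + G) ^ k *
      (F / (F + G) * (w i * f i ^ k / F ^ k) + G / (F + G) * (w i * g i ^ k / G ^ k)) := by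
    intro i _
    have hc := (convexOn_pow k).2 (Set.mem_Ici.2 (div_nonneg (hf i) hF.le))
      (Set.mem_Ici.2 (div_nonneg (hg i) hG.le)) (show 0 ≤ F / (F + G) by positivity)
      (show 0 ≤ G / (F + G) by positivity) (by field_simp)
    simp only [smul_eq_mul] at hc
    have e : F / (F + G) * (f i / F) + G / (F + G) * (g i / G) = (f i + g i) / (F + G) := by
      field_simp
    rw [e, div_pow, div_pow, div_pow, div_le_iff₀ (by positivity)] at hc
    calc _ ≤ w i * _ := mul_le_mul_of_nonneg_left hc (hw i)
      _ = _ := by ring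
  refine (Finset.sum_le_sum hpt).trans ?_
  rw [← Finset.mul_sum, Finset.sum_add_distrib, ← Finset.mul_sum, ← Finset.mul_sum,
    ← Finset.sum_div, ← Finset.sum_div]
  have h1 : (∑ i ∈ s, w i * f i ^ k) / F ^ k ≤ 1 := (div_le_one (by positivity)).2 hfF
  have h2 : (∑ i ∈ s, w i * g i ^ k) / G ^ k ≤ 1 := (div_le_one (by positivity)).2 hgG
  calc _ ≤ (F + G) ^ k * (F / (F + G) * 1 + G / (F + G) * 1) := by gcongr
    _ = _ := by field_simp

/-- Hypercontractivity for affine functions of signs, with values in a normed space. -/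
theorem sum_norm_add_smul_pow_le {X : Type*} [NormedAddCommGroup X] [NormedSpace ℝ X] {k : ℕ}
    (hk0 : k ≠ 0) {ρ : ℝ} (hρ0 : 0 ≤ ρ) (hρ1 : 2 * ρ ^ 2 ≤ 1) (hk : k * (8 * ρ ^ 2) ≤ 1) {n : ℕ}
    (v : Fin n → X) (z : X) :
    (2 ^ n : ℝ)⁻¹ * ∑ δ : Fin n → Bool, ‖z + ρ • ∑ i, sgn (δ i) • v i‖ ^ (2 * k) ≤
      ((2 ^ n : ℝ)⁻¹ * ∑ δ : Fin n → Bool, ‖z + ∑ i, sgn (δ i) • v i‖ ^ 2) ^ k := by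
  induction n generalizing z with
  | zero => simp [pow_mul]
  | succ n ih =>
    simp only [sum_fin_succ_arrow, Fin.sum_univ_succ, Fin.cons_zero, Fin.cons_succ,
      Fintype.sum_bool, sgn, if_true, Bool.false_eq_true, if_false]
    have ih1 := ih (fun i => v i.succ) (z + v 0)
    have ih2 := ih (fun i => v i.succ) (z - v 0)
    obtain ⟨S, hS⟩ : ∃ S : (Fin n → Bool) → X, ∀ δ,
      ∑ i, (if δ i = true then (1 : ℝ) else -1) • v i.succ = S δ := ⟨_, fun _ => rfl⟩
    simp only [sgn, hS] at ih1 ih2 ⊢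
    have hmink := sum_mul_add_pow_le (s := Finset.univ) (w := fun _ => (2 ^ n : ℝ)⁻¹)
      (f := fun δ => ‖z + v 0 + ρ • S δ‖ ^ 2) (g := fun δ => ‖z - v 0 + ρ • S δ‖ ^ 2)
      (F := (2 ^ n : ℝ)⁻¹ * ∑ δ, ‖z + v 0 + S δ‖ ^ 2)
      (G := (2 ^ n : ℝ)⁻¹ * ∑ δ, ‖z - v 0 + S δ‖ ^ 2) (k := k)
      (fun _ => by positivity) (fun _ => by positivity) (fun _ => by positivity)
      (by positivity) (by positivity) hk0
      (by simpa only [← pow_mul, ← Finset.mul_sum] using ih1)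
      (by simpa only [← pow_mul, ← Finset.mul_sum] using ih2)
    calc _ = ∑ δ, (2 ^ n : ℝ)⁻¹ * ((‖(z + ρ • S δ) + ρ • v 0‖ ^ (2 * k) +
            ‖(z + ρ • S δ) - ρ • v 0‖ ^ (2 * k)) / 2) := by
          rw [← Finset.mul_sum, ← Finset.sum_div, Finset.sum_add_distrib, pow_succ, mul_inv]
          have e1 : ∀ δ, z + ρ • ((1 : ℝ) • v 0 + S δ) = (z + ρ • S δ) + ρ • v 0 := fun δ => by
            module
          have e2 : ∀ δ, z + ρ • ((-1 : ℝ) • v 0 + S δ) = (z + ρ • S δ) - ρ • v 0 := fun δ => by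
            module
          simp only [e1, e2]
          ring
      _ ≤ ∑ δ, (2 ^ n : ℝ)⁻¹ * ((‖(z + ρ • S δ) + v 0‖ ^ 2 +
            ‖(z + ρ • S δ) - v 0‖ ^ 2) / 2) ^ k := by
          gcongr with δ
          exact two_point_norm_pow_le hρ0 hρ1 hk _ _
      _ = (∑ δ, (2 ^ n : ℝ)⁻¹ * (‖z + v 0 + ρ • S δ‖ ^ 2 + ‖z - v 0 + ρ • S δ‖ ^ 2) ^ k) / 2 ^ k := by
          rw [Finset.sum_div]
          refine Finset.sum_congr rfl fun δ _ => ?_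
          rw [div_pow, add_right_comm z, sub_add_eq_add_sub z]
          ring
      _ ≤ _ := by
          refine (div_le_div_of_nonneg_right hmink (by positivity)).trans_eq ?_
          rw [← div_pow, pow_succ, mul_inv]
          have e1 : ∀ δ, z + ((1 : ℝ) • v 0 + S δ) = z + v 0 + S δ := fun δ => by
            module
          have e2 : ∀ δ, z + ((-1 : ℝ) • v 0 + S δ) = z - v 0 + S δ := fun δ => by
            module
          simp only [e1, e2]
          congr 1
          ring

theorem sq_le_mul_of_le_mul_add {a b c D : ℝ} (hb : 0 ≤ b) (hD : 0 < D)
    (hc : c ≤ D * b ^ 2) (h : ∀ t : ℝ, 0 < t → b ≤ t * a + c / t ^ 2) : b ≤ 8 * D * a ^ 2 := by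
  rcases hb.eq_or_lt with rfl | hb
  · positivity
  set t := √(2 * D * b)
  have ht : 0 < t := Real.sqrt_pos.2 (by positivity)
  have ht2 : t ^ 2 = 2 * D * b := Real.sq_sqrt (by positivity)
  have h1 := h t ht
  have h2 : c / t ^ 2 ≤ b / 2 := by
    rw [ht2, div_le_iff₀ (by positivity)]
    linarith
  have h3 : b ≤ 2 * (t * a) := by linarith
  have h4 : b ^ 2 ≤ (2 * (t * a)) ^ 2 := by gcongr
  rw [mul_pow, mul_pow, ht2] at h4
  nlinarith

/-- The **Kahane–Khintchine inequality**, comparing an even moment with the `p`-th moment. -/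
theorem exists_kahane_const (k : ℕ) (hk0 : k ≠ 0) : ∃ K : ℝ, 0 < K ∧
    ∀ (X : Type*) [NormedAddCommGroup X] [NormedSpace ℝ X] (p : ℝ), 1 ≤ p →
    ∀ (n : ℕ) (v : Fin n → X),
      (2 ^ n : ℝ)⁻¹ * ∑ δ : Fin n → Bool, ‖∑ i, sgn (δ i) • v i‖ ^ (2 * k) ≤
        (K * ((2 ^ n : ℝ)⁻¹ * ∑ δ : Fin n → Bool, ‖∑ i, sgn (δ i) • v i‖ ^ p) ^ (1 / p)) ^
          (2 * k) := by
  have hyper : ∀ k : ℕ, k ≠ 0 → ∃ D : ℝ, 0 < D ∧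
      ∀ (X : Type _) [NormedAddCommGroup X] [NormedSpace ℝ X] (n : ℕ) (v : Fin n → X),
      (2 ^ n : ℝ)⁻¹ * ∑ δ : Fin n → Bool, ‖∑ i, sgn (δ i) • v i‖ ^ (2 * k) ≤
        D ^ k * ((2 ^ n : ℝ)⁻¹ * ∑ δ : Fin n → Bool, ‖∑ i, sgn (δ i) • v i‖ ^ 2) ^ k := by
    intro k hk
    have hk1 : (1 : ℝ) ≤ k := by exact_mod_cast Nat.one_le_iff_ne_zero.2 hk
    refine ⟨8 * k, by positivity, fun X _ _ n v => ?_⟩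
    have hsq : √((8 * k : ℝ)⁻¹) ^ 2 = (8 * k : ℝ)⁻¹ := Real.sq_sqrt (by positivity)
    have h := sum_norm_add_smul_pow_le hk (Real.sqrt_nonneg ((8 * k : ℝ)⁻¹))
      (by rw [hsq, ← div_eq_mul_inv, div_le_one (by positivity)]; linarith)
      (by rw [hsq]; field_simp; rfl) v 0
    simp only [zero_add, norm_smul, mul_pow, ← Finset.mul_sum, Real.norm_eq_abs,
      abs_of_nonneg (Real.sqrt_nonneg _)] at h
    rw [pow_mul, hsq, mul_left_comm, inv_pow, inv_mul_le_iff₀ (by positivity)] at h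
    rwa [← mul_pow] at h
  obtain ⟨D, hD, hDX⟩ := hyper k hk0
  obtain ⟨D', hD', hDX'⟩ := hyper 2 two_ne_zero
  refine ⟨√(D * (8 * D' ^ 2)), Real.sqrt_pos.2 (by positivity), fun X _ _ p hp n v => ?_⟩
  set g : (Fin n → Bool) → ℝ := fun δ => ‖∑ i, sgn (δ i) • v i‖ with hg
  have hg0 : ∀ δ, 0 ≤ g δ := fun _ => norm_nonneg _
  have hmean : (2 ^ n : ℝ)⁻¹ * ∑ δ, g δ ≤ ((2 ^ n : ℝ)⁻¹ * ∑ δ, g δ ^ p) ^ (1 / p) := by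
    simp only [Finset.mul_sum]
    exact Real.arith_mean_le_rpow_mean _ _ _ (fun _ _ => by positivity)
      (by simp) (fun δ _ => hg0 δ) hp
  have hsq : (2 ^ n : ℝ)⁻¹ * ∑ δ, g δ ^ 2 ≤ 8 * D' ^ 2 * ((2 ^ n : ℝ)⁻¹ * ∑ δ, g δ) ^ 2 := by
    refine sq_le_mul_of_le_mul_add (c := (2 ^ n : ℝ)⁻¹ * ∑ δ, g δ ^ 4)
      (by positivity) (by positivity) (hDX' X n v) fun t ht => ?_
    have e : t * ((2 ^ n : ℝ)⁻¹ * ∑ δ, g δ) + (2 ^ n : ℝ)⁻¹ * (∑ δ, g δ ^ 4) / t ^ 2 =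
        (2 ^ n : ℝ)⁻¹ * ∑ δ, (t * g δ + g δ ^ 4 / t ^ 2) := by
      rw [Finset.sum_add_distrib, ← Finset.mul_sum, ← Finset.sum_div]
      ring
    rw [e]
    gcongr with δ
    rcases le_total (g δ) t with h | h
    · have : 0 ≤ g δ ^ 4 / t ^ 2 := by positivity
      nlinarith [hg0 δ]
    · have : g δ ^ 2 ≤ g δ ^ 4 / t ^ 2 := by
        rw [le_div_iff₀ (by positivity)]
        calc _ ≤ g δ ^ 2 * g δ ^ 2 := by gcongr
          _ = _ := by ring
      have := mul_nonneg ht.le (hg0 δ)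
      linarith
  refine (hDX X n v).trans ?_
  rw [← mul_pow, pow_mul]
  refine pow_le_pow_left₀ (by positivity) ?_ k
  rw [mul_pow, Real.sq_sqrt (by positivity), mul_assoc D]
  refine mul_le_mul_of_nonneg_left (hsq.trans ?_) hD.le
  gcongr

/-- Cotype `q` in the form of an inequality for a larger natural exponent. -/
theorem CotypeC.sum_norm_pow_le {X : Type*} [NormedAddCommGroup X] [NormedSpace ℝ X] {q C : ℝ}
    (h : CotypeC X q C) (hq : 0 < q) (hC : 0 < C) {r : ℕ} (hr : q ≤ r) {m : ℕ} (v : Fin m → X) :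
    ∑ i, ‖v i‖ ^ r ≤
      C ^ r * ((2 ^ m : ℝ)⁻¹ * ∑ δ : Fin m → Bool, ‖∑ i, sgn (δ i) • v i‖ ^ r) := by
  have hqr : 1 ≤ (r : ℝ) / q := (one_le_div hq).2 hr
  have pow_eq : ∀ a : ℝ, 0 ≤ a → (a ^ q) ^ ((r : ℝ) / q) = a ^ r := fun a ha => by
    rw [← Real.rpow_mul ha, mul_div_cancel₀ _ hq.ne', Real.rpow_natCast]
  have h1 := h m v
  rw [div_le_iff₀ (by positivity), mul_comm _ (C ^ q)] at h1
  calc ∑ i, ‖v i‖ ^ r = ∑ i, (‖v i‖ ^ q) ^ ((r : ℝ) / q) :=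
        Finset.sum_congr rfl fun i _ => (pow_eq _ (norm_nonneg _)).symm
    _ ≤ (∑ i, ‖v i‖ ^ q) ^ ((r : ℝ) / q) := by
        have split : ∀ a : ℝ, 0 ≤ a → a ^ ((r : ℝ) / q) = a * a ^ ((r : ℝ) / q - 1) := by
          intro a ha
          rw [mul_comm, ← Real.rpow_add_one' ha (by linarith), sub_add_cancel]
        rw [split _ (by positivity), Finset.sum_mul]
        refine Finset.sum_le_sum fun i _ => ?_
        rw [split _ (by positivity)]
        gcongr
        exact Finset.single_le_sum (f := fun i => ‖v i‖ ^ q) (fun _ _ => by positivity)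
            (Finset.mem_univ i)
    _ ≤ (C ^ q * ((2 ^ m : ℝ)⁻¹ * ∑ δ : Fin m → Bool, ‖∑ i, sgn (δ i) • v i‖ ^ q)) ^
          ((r : ℝ) / q) := by gcongr
    _ ≤ _ := by
        rw [Real.mul_rpow (by positivity) (by positivity), pow_eq C hC.le]
        gcongr
        simp only [Finset.mul_sum]
        refine (Real.rpow_arith_mean_le_arith_mean_rpow _ _ _ (fun _ _ => by positivity)
          (by simp) (fun _ _ => by positivity) hqr).trans_eq ?_
        exact Finset.sum_congr rfl fun δ _ => by rw [pow_eq _ (norm_nonneg _)]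

theorem sgn_beq (a b : Bool) : sgn (a == b) = sgn a * sgn b := by
  cases a <;> cases b <;> simp [sgn]

/-- Randomly splitting a Rademacher sum into `M` blocks in a space of cotype `r`. -/
theorem sum_blocks_le {X : Type*} [NormedAddCommGroup X] [NormedSpace ℝ X] {r : ℕ} {C : ℝ}
    (hcot : ∀ (m : ℕ) (v : Fin m → X), ∑ i, ‖v i‖ ^ r ≤
      C ^ r * ((2 ^ m : ℝ)⁻¹ * ∑ δ : Fin m → Bool, ‖∑ i, sgn (δ i) • v i‖ ^ r))
    {M : ℕ} (hM : M ≠ 0) {n : ℕ} (v : Fin n → X) :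
    ∑ k : Fin M, ∑ y : Fin n → Bool × Fin M, (∏ _i : Fin n, (2 * M : ℝ)⁻¹) *
        ‖∑ i, (if (y i).2 = k then sgn (y i).1 else 0) • v i‖ ^ r ≤
      C ^ r * ((2 ^ n : ℝ)⁻¹ * ∑ δ : Fin n → Bool, ‖∑ i, sgn (δ i) • v i‖ ^ r) := by
  have hcolor : ∀ c : Fin n → Fin M, ∑ ε : Fin n → Bool, ∑ k : Fin M,
      ‖∑ i, (if c i = k then sgn (ε i) else 0) • v i‖ ^ r ≤
        C ^ r * ∑ δ : Fin n → Bool, ‖∑ i, sgn (δ i) • v i‖ ^ r := by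
    intro c
    calc _ ≤ ∑ ε : Fin n → Bool, C ^ r * ((2 ^ M : ℝ)⁻¹ * ∑ δ : Fin M → Bool,
            ‖∑ i, sgn (ε i == δ (c i)) • v i‖ ^ r) := by
          refine Finset.sum_le_sum fun ε _ => (hcot M _).trans_eq ?_
          congr! 5 with δ
          simp only [Finset.smul_sum]
          rw [Finset.sum_comm]
          refine Finset.sum_congr rfl fun i _ => ?_
          rw [Finset.sum_eq_single (c i) (fun k _ hk => by simp [hk.symm]) (by simp), if_pos rfl,
            smul_smul, sgn_beq, mul_comm]
      _ = C ^ r * ((2 ^ M : ℝ)⁻¹ * ∑ δ : Fin M → Bool, ∑ ε : Fin n → Bool,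
            ‖∑ i, sgn (ε i == δ (c i)) • v i‖ ^ r) := by
          rw [Finset.sum_comm, Finset.mul_sum, Finset.mul_sum]
      _ = C ^ r * ((2 ^ M : ℝ)⁻¹ * ∑ _δ : Fin M → Bool, ∑ ε : Fin n → Bool,
            ‖∑ i, sgn (ε i) • v i‖ ^ r) := by
          congr! 3 with δ
          have hinv : Function.Involutive fun (ε : Fin n → Bool) i => ε i == δ (c i) := by
            intro ε
            funext i
            cases h : ε i <;> cases h' : δ (c i) <;> simp [h, h']
          exact hinv.bijective.sum_comp fun ε => ‖∑ i, sgn (ε i) • v i‖ ^ r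
      _ = _ := by simp
  calc _ = ((2 * M : ℝ)⁻¹) ^ n * ∑ c : Fin n → Fin M, ∑ ε : Fin n → Bool, ∑ k : Fin M,
        ‖∑ i, (if c i = k then sgn (ε i) else 0) • v i‖ ^ r := by
        simp only [Finset.prod_const, Finset.card_univ, Fintype.card_fin, ← Finset.mul_sum]
        congr 1
        rw [Finset.sum_comm, ← (Equiv.arrowProdEquivProdArrow (Fin n) (fun _ => Bool)
          (fun _ => Fin M)).symm.sum_comp, Fintype.sum_prod_type_right]
        rfl
    _ ≤ ((2 * M : ℝ)⁻¹) ^ n * ∑ _c : Fin n → Fin M,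
        C ^ r * ∑ δ : Fin n → Bool, ‖∑ i, sgn (δ i) • v i‖ ^ r := by
        gcongr with c
        exact hcolor c
    _ = _ := by
        have : (M : ℝ) ≠ 0 := by exact_mod_cast hM
        simp [mul_pow]
        field_simp

/-- The mass of a point under the biased measure on a single coordinate. -/
def coinWeight (α : ℝ) (b : Bool) : ℝ := if b then α else 1 - α

/-- The one-coordinate kernel which keeps `a` with probability `s` and otherwise resamples it
from the biased measure. -/
def resample (α s : ℝ) (a b : Bool) : ℝ := s * (if a = b then 1 else 0) + (1 - s) * coinWeight α b

/-- The logarithmic derivative of `resample α s a b` in `s`. -/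
def noiseCoeff (α s : ℝ) (a b : Bool) : ℝ :=
  ((if a = b then 1 else 0) - coinWeight α b) / resample α s a b

theorem coinWeight_pos {α : ℝ} (h0 : 0 < α) (h1 : α < 1) (b : Bool) : 0 < coinWeight α b := by
  cases b <;> simp [coinWeight, h0, h1]

theorem sum_resample (α s : ℝ) (a : Bool) : ∑ b, resample α s a b = 1 := by
  cases a <;> simp [coinWeight, resample] <;> ring

theorem coinWeight_mul_resample (α s : ℝ) (a b : Bool) :
    coinWeight α a * resample α s a b = coinWeight α b * resample α s b a := by
  cases a <;> cases b <;> simp [coinWeight, resample] <;> ring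

theorem resample_pos {α s : ℝ} (h0 : 0 < α) (h1 : α < 1) (hs0 : 0 ≤ s) (hs1 : s < 1)
    (a b : Bool) : 0 < resample α s a b := by
  have := mul_pos (sub_pos.2 hs1) (coinWeight_pos h0 h1 b)
  unfold resample
  split_ifs <;> linarith

/-- A centred two-valued variable is dominated in the convex order by a sparse symmetric one. -/
theorem convexOn_two_point_le {φ : ℝ → ℝ} (hφ : ConvexOn ℝ Set.univ φ) {L a b π τ : ℝ}
    (ha0 : 0 ≤ a) (ha1 : a ≤ 1) (hb0 : 0 ≤ b) (hb1 : b ≤ 1) (hπ0 : 0 ≤ π) (hπ1 : π ≤ 1)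
    (hab : (1 - π) * a = π * b) (hτ : π * b ≤ τ) :
    (1 - π) * φ (a * L) + π * φ (-(b * L)) ≤
      (1 - 2 * τ) * φ 0 + τ * φ L + τ * φ (-L) := by
  have h1 := hφ.2 (Set.mem_univ L) (Set.mem_univ 0) ha0 (sub_nonneg.2 ha1) (by ring)
  have h2 := hφ.2 (Set.mem_univ (-L)) (Set.mem_univ 0) hb0 (sub_nonneg.2 hb1) (by ring)
  have h3 := hφ.2 (Set.mem_univ L) (Set.mem_univ (-L)) (show (0 : ℝ) ≤ 1 / 2 by norm_num)
    (show (0 : ℝ) ≤ 1 / 2 by norm_num) (by norm_num)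
  simp only [smul_eq_mul, mul_zero, add_zero, mul_neg, add_neg_cancel] at h1 h2 h3
  have h4 := mul_le_mul_of_nonneg_left h1 (sub_nonneg.2 hπ1)
  have h5 := mul_le_mul_of_nonneg_left h2 hπ0
  have h6 := mul_nonneg (sub_nonneg.2 hτ)
    (show 0 ≤ φ L + φ (-L) - 2 * φ 0 by linarith)
  have h7 : (1 - π) * (a * φ L + (1 - a) * φ 0) =
      (π * b) * φ L + ((1 - π) - π * b) * φ 0 := by rw [← hab]; ring
  linarith

theorem convexOn_norm_add_smul_pow {X : Type*} [NormedAddCommGroup X] [NormedSpace ℝ X]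
    (z v : X) (r : ℕ) : ConvexOn ℝ Set.univ fun t : ℝ => ‖z + t • v‖ ^ r := by
  refine ConvexOn.pow ⟨convex_univ, fun s _ t _ a b ha hb hab => ?_⟩
    (fun _ _ => norm_nonneg _) r
  calc ‖z + (a • s + b • t) • v‖ = ‖a • (z + s • v) + b • (z + t • v)‖ := by
        congr 1
        obtain rfl : b = 1 - a := by linarith
        simp only [smul_eq_mul]
        module
    _ ≤ ‖a • (z + s • v)‖ + ‖b • (z + t • v)‖ := norm_add_le _ _
    _ = _ := by rw [norm_smul_of_nonneg ha, norm_smul_of_nonneg hb]; rfl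

theorem sum_resample_mul_norm_pow_le {X : Type*} [NormedAddCommGroup X] [NormedSpace ℝ X]
    {α s κ : ℝ} (h0 : 0 < α) (h1 : α < 1) (hs0 : 0 ≤ s) (hs1 : s < 1) (hκ : 4 ≤ κ)
    (hκα : ∀ b, 1 ≤ κ * coinWeight α b) {M : ℕ} (hM : M ≠ 0) (hMs : M * (1 - s) ≤ 2)
    (k : Fin M) (r : ℕ) (b : Bool) (z v : X) :
    ∑ a, resample α s b a * ‖z + noiseCoeff α s a b • v‖ ^ r ≤
      ∑ c : Bool × Fin M, (2 * M : ℝ)⁻¹ *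
        ‖z + (κ / (1 - s) * if c.2 = k then sgn c.1 else 0) • v‖ ^ r := by
  have hs : 0 < 1 - s := sub_pos.2 hs1
  have hM0 : (0 : ℝ) < M := by exact_mod_cast Nat.pos_of_ne_zero hM
  have hw := coinWeight_pos h0 h1 b
  have hw1 : coinWeight α b < 1 := by
    cases b <;> simp [coinWeight, h0, h1]
  have hR := resample_pos h0 h1 hs0 hs1 b b
  have hRw : coinWeight α b ≤ resample α s b b := by
    simp only [resample, if_true]; nlinarith
  have hR1 : resample α s b b = 1 - (1 - s) * (1 - coinWeight α b) := by
    simp only [resample, if_true]; ring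
  have hnot : coinWeight α (!b) = 1 - coinWeight α b := by
    cases b <;> simp [coinWeight]
  have hRn : resample α s b (!b) = (1 - s) * (1 - coinWeight α b) := by
    simp [resample, hnot]
  have key := convexOn_two_point_le (convexOn_norm_add_smul_pow z v r) (L := κ / (1 - s))
    (a := (1 - coinWeight α b) * (1 - s) / (κ * resample α s b b)) (b := 1 / κ)
    (π := (1 - s) * (1 - coinWeight α b)) (τ := (2 * M : ℝ)⁻¹)
    (by have := sub_pos.2 hw1; positivity)
    (by
      rw [div_le_one (by positivity)]
      nlinarith [hκα b])
    (by positivity) (by rw [div_le_one (by positivity)]; linarith)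
    (by nlinarith) (by nlinarith) (by rw [← hR1]; field_simp)
    (by
      rw [mul_one_div, div_le_iff₀ (by positivity), inv_mul_eq_div, le_div_iff₀ (by positivity)]
      nlinarith [mul_pos hM0 hs])
  have hL : ∀ F : Bool → ℝ, ∑ a, F a = F b + F (!b) := by
    intro F
    cases b <;> simp [add_comm]
  rw [hL, hRn, hR1]
  have e1 : noiseCoeff α s b b =
      (1 - coinWeight α b) * (1 - s) / (κ * resample α s b b) * (κ / (1 - s)) := by
    simp only [noiseCoeff, if_true]
    field_simp
  have e2 : noiseCoeff α s (!b) b = -(1 / κ * (κ / (1 - s))) := by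
    have : (!b) ≠ b := by simp
    simp only [noiseCoeff, resample, if_neg this]
    field_simp
    ring
  rw [e1, e2]
  refine key.trans_eq ?_
  rw [Fintype.sum_prod_type, Fintype.sum_bool]
  have hsum : ∀ t : ℝ, ∑ x : Fin M, (2 * M : ℝ)⁻¹ *
      ‖z + (κ / (1 - s) * if x = k then t else 0) • v‖ ^ r =
        (2 * M : ℝ)⁻¹ * ‖z + (κ / (1 - s) * t) • v‖ ^ r +
          (M - 1) * ((2 * M : ℝ)⁻¹ * ‖z‖ ^ r) := by
    intro t
    rw [← Finset.add_sum_erase _ _ (Finset.mem_univ k)]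
    congr 1
    · simp
    · rw [Finset.sum_congr rfl fun x hx => by
        rw [if_neg (Finset.ne_of_mem_erase hx), mul_zero, zero_smul, add_zero]]
      simp [Finset.card_erase_of_mem, Nat.cast_sub (Nat.one_le_iff_ne_zero.2 hM)]
  refine Eq.trans ?_ (congrArg₂ (· + ·) (hsum (sgn true)) (hsum (sgn false))).symm
  simp only [sgn, if_true, Bool.false_eq_true, if_false, zero_smul, add_zero, mul_one, mul_neg]
  field_simp
  ring

/-- Conditional moments of the noise: a Rademacher sum dominates, with a loss that is integrable
in `s` near `1`. -/
theorem sum_prod_resample_mul_norm_pow_le {X : Type*} [NormedAddCommGroup X] [NormedSpace ℝ X]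
    {r : ℕ} {C : ℝ}
    (hcot : ∀ (m : ℕ) (v : Fin m → X), ∑ i, ‖v i‖ ^ r ≤
      C ^ r * ((2 ^ m : ℝ)⁻¹ * ∑ δ : Fin m → Bool, ‖∑ i, sgn (δ i) • v i‖ ^ r))
    {α s κ : ℝ} (h0 : 0 < α) (h1 : α < 1) (hs0 : 0 ≤ s) (hs1 : s < 1) (hκ : 4 ≤ κ)
    (hκα : ∀ b, 1 ≤ κ * coinWeight α b) {n : ℕ} (y : Fin n → Bool) (v : Fin n → X) :
    ∑ x : Fin n → Bool, (∏ i, resample α s (y i) (x i)) *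
        ‖∑ i, noiseCoeff α s (x i) (y i) • v i‖ ^ r ≤
      (1 - s) * (κ / (1 - s)) ^ r *
        (C ^ r * ((2 ^ n : ℝ)⁻¹ * ∑ δ : Fin n → Bool, ‖∑ i, sgn (δ i) • v i‖ ^ r)) := by
  have hs : 0 < 1 - s := sub_pos.2 hs1
  set M := ⌈1 / (1 - s)⌉₊ with hMdef
  have hMle : 1 ≤ M * (1 - s) := (div_le_iff₀ hs).1 (Nat.le_ceil _)
  have hM2 : M * (1 - s) ≤ 2 := by
    have := (Nat.ceil_lt_add_one (show 0 ≤ 1 / (1 - s) by positivity)).le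
    calc M * (1 - s) ≤ (1 / (1 - s) + 1) * (1 - s) := by gcongr
      _ = 1 + (1 - s) := by field_simp
      _ ≤ 2 := by linarith
  have hM : M ≠ 0 := by
    intro h
    rw [h] at hMle
    norm_num at hMle
  set E := ∑ x : Fin n → Bool, (∏ i, resample α s (y i) (x i)) *
        ‖∑ i, noiseCoeff α s (x i) (y i) • v i‖ ^ r with hE
  have hE0 : 0 ≤ E := Finset.sum_nonneg fun x _ => mul_nonneg
    (Finset.prod_nonneg fun i _ => (resample_pos h0 h1 hs0 hs1 _ _).le) (by positivity)
  have hk : ∀ k : Fin M, E ≤ (κ / (1 - s)) ^ r * ∑ y : Fin n → Bool × Fin M,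
      (∏ _i : Fin n, (2 * M : ℝ)⁻¹) *
        ‖∑ i, (if (y i).2 = k then sgn (y i).1 else 0) • v i‖ ^ r := by
    intro k
    have := sum_prod_weight_mul_norm_pow_le (X := X) r
      (fun _ : Bool × Fin M => (2 * M : ℝ)⁻¹)
      (fun c => κ / (1 - s) * if c.2 = k then sgn c.1 else 0) (fun _ => by positivity)
      (fun i a => resample α s (y i) a) (fun i a => noiseCoeff α s a (y i))
      (fun i a => (resample_pos h0 h1 hs0 hs1 _ _).le)
      (fun i z v => sum_resample_mul_norm_pow_le h0 h1 hs0 hs1 hκ hκα hM hM2 k r (y i) z v) v 0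
    simp only [zero_add, mul_smul, ← Finset.smul_sum, norm_smul, mul_pow] at this
    refine this.trans_eq ?_
    rw [Finset.mul_sum, Real.norm_of_nonneg (by positivity)]
    exact Finset.sum_congr rfl fun _ _ => by ring
  have hsum : M * E ≤ (κ / (1 - s)) ^ r *
      (C ^ r * ((2 ^ n : ℝ)⁻¹ * ∑ δ : Fin n → Bool, ‖∑ i, sgn (δ i) • v i‖ ^ r)) := by
    calc M * E = ∑ _k : Fin M, E := by simp
      _ ≤ _ := Finset.sum_le_sum fun k _ => hk k
      _ ≤ _ := by
        rw [← Finset.mul_sum]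
        gcongr
        exact sum_blocks_le hcot hM v
  calc E ≤ (M * (1 - s)) * E := le_mul_of_one_le_left hE0 hMle
    _ = (1 - s) * (M * E) := by ring
    _ ≤ (1 - s) * _ := mul_le_mul_of_nonneg_left hsum hs.le
    _ = _ := by ring

theorem sum_prod_resample (α s : ℝ) {n : ℕ} (x : Fin n → Bool) :
    ∑ y : Fin n → Bool, ∏ i, resample α s (x i) (y i) = 1 := by
  rw [sum_prod_weight fun i b => resample α s (x i) b]
  simp only [sum_resample, Finset.prod_const_one]

theorem sum_prod_resample_mul_norm_rpow_le {X : Type*} [NormedAddCommGroup X] [NormedSpace ℝ X]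
    {k : ℕ} (hk0 : k ≠ 0) {C p K : ℝ} (hC : 0 < C) (hK : 0 < K) (hp : 1 ≤ p)
    (hpk : p ≤ (2 * k : ℕ))
    (hcot : ∀ (m : ℕ) (v : Fin m → X), ∑ i, ‖v i‖ ^ (2 * k) ≤
      C ^ (2 * k) * ((2 ^ m : ℝ)⁻¹ * ∑ δ : Fin m → Bool, ‖∑ i, sgn (δ i) • v i‖ ^ (2 * k)))
    (hkah : ∀ (n : ℕ) (v : Fin n → X),
      (2 ^ n : ℝ)⁻¹ * ∑ δ : Fin n → Bool, ‖∑ i, sgn (δ i) • v i‖ ^ (2 * k) ≤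
        (K * ((2 ^ n : ℝ)⁻¹ * ∑ δ : Fin n → Bool, ‖∑ i, sgn (δ i) • v i‖ ^ p) ^ (1 / p)) ^
          (2 * k))
    {α s κ : ℝ} (h0 : 0 < α) (h1 : α < 1) (hs0 : 0 ≤ s) (hs1 : s < 1) (hκ : 4 ≤ κ)
    (hκα : ∀ b, 1 ≤ κ * coinWeight α b) {n : ℕ} (y : Fin n → Bool) (v : Fin n → X) :
    ∑ x : Fin n → Bool, (∏ i, resample α s (y i) (x i)) *
        ‖∑ i, noiseCoeff α s (x i) (y i) • v i‖ ^ p ≤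
      (κ * C * K * (1 - s) ^ (1 / ((2 * k : ℕ) : ℝ) - 1)) ^ p *
        ((2 ^ n : ℝ)⁻¹ * ∑ δ : Fin n → Bool, ‖∑ i, sgn (δ i) • v i‖ ^ p) := by
  have hs : 0 < 1 - s := sub_pos.2 hs1
  have hp0 : 0 < p := by linarith
  have hκ0 : 0 < κ := by linarith
  set r := 2 * k with hr
  have hr0 : r ≠ 0 := by omega
  have hrR : (0 : ℝ) < r := by exact_mod_cast Nat.pos_of_ne_zero hr0
  set B := (2 ^ n : ℝ)⁻¹ * ∑ δ : Fin n → Bool, ‖∑ i, sgn (δ i) • v i‖ ^ p with hB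
  have hB0 : 0 ≤ B := by positivity
  set D := κ * C * K * (1 - s) ^ (1 / (r : ℝ) - 1) with hD
  have hD0 : 0 < D := by positivity
  have hW0 : ∀ x : Fin n → Bool, 0 ≤ ∏ i, resample α s (y i) (x i) := fun x =>
    Finset.prod_nonneg fun i _ => (resample_pos h0 h1 hs0 hs1 _ _).le
  have pow_eq : ∀ a : ℝ, 0 ≤ a → (a ^ p) ^ ((r : ℝ) / p) = a ^ r := fun a ha => by
    rw [← Real.rpow_mul ha, mul_div_cancel₀ _ hp0.ne', Real.rpow_natCast]
  have hspow : (1 - s) * (1 / (1 - s)) ^ r = ((1 - s) ^ (1 / (r : ℝ) - 1)) ^ r := by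
    rw [← Real.rpow_natCast (_ ^ (_ - _)), ← Real.rpow_mul hs.le,
      sub_mul (1 / (r : ℝ)), one_mul, one_div_mul_cancel hrR.ne', Real.rpow_sub hs,
      Real.rpow_one, Real.rpow_natCast, one_div, inv_pow, div_eq_mul_inv]
  have hDB : ∑ x : Fin n → Bool, (∏ i, resample α s (y i) (x i)) *
        ‖∑ i, noiseCoeff α s (x i) (y i) • v i‖ ^ r ≤ (D * B ^ (1 / p)) ^ r := by
    refine (sum_prod_resample_mul_norm_pow_le hcot h0 h1 hs0 hs1 hκ hκα y v).trans ?_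
    calc _ ≤ (1 - s) * (κ / (1 - s)) ^ r * (C ^ r * (K * B ^ (1 / p)) ^ r) := by
          gcongr
          exact hkah n v
      _ = κ ^ r * C ^ r * K ^ r * ((1 - s) * (1 / (1 - s)) ^ r) * (B ^ (1 / p)) ^ r := by
          rw [div_eq_mul_one_div κ, mul_pow, mul_pow]
          ring
      _ = _ := by rw [hspow, hD]; ring
  have hDBp : (D * B ^ (1 / p)) ^ p = D ^ p * B := by
    rw [Real.mul_rpow hD0.le (by positivity), ← Real.rpow_mul hB0, one_div_mul_cancel hp0.ne',
      Real.rpow_one]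
  have hL0 : 0 ≤ ∑ x : Fin n → Bool, (∏ i, resample α s (y i) (x i)) *
      ‖∑ i, noiseCoeff α s (x i) (y i) • v i‖ ^ p :=
    Finset.sum_nonneg fun x _ => mul_nonneg (hW0 x) (by positivity)
  rw [← hDBp, ← Real.rpow_le_rpow_iff hL0 (by positivity) (div_pos hrR hp0),
    pow_eq _ (by positivity)]
  refine le_trans ?_ hDB
  refine (Real.rpow_arith_mean_le_arith_mean_rpow _ _ _ (fun x _ => hW0 x)
    (sum_prod_resample α s y) (fun _ _ => by positivity) ((one_le_div hp0).2 hpk)).trans_eq ?_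
  exact Finset.sum_congr rfl fun x _ => by rw [pow_eq _ (norm_nonneg _)]

/-- The semigroup which resamples the coordinates independently. -/
def resampleOp {X : Type*} [AddCommGroup X] [Module ℝ X] {n : ℕ} (α s : ℝ)
    (f : (Fin n → Bool) → X) (x : Fin n → Bool) : X :=
  ∑ y : Fin n → Bool, (∏ i, resample α s (x i) (y i)) • f y

theorem resampleOp_one {X : Type*} [AddCommGroup X] [Module ℝ X] {n : ℕ} (α : ℝ)
    (f : (Fin n → Bool) → X) (x : Fin n → Bool) : resampleOp α 1 f x = f x := by
  rw [resampleOp, Finset.sum_eq_single x]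
  · simp [resample]
  · intro y _ hy
    obtain ⟨i, hi⟩ := Function.ne_iff.1 hy.symm
    rw [Finset.prod_eq_zero (Finset.mem_univ i) (by simp [resample, hi]), zero_smul]
  · simp

theorem resampleOp_zero {X : Type*} [AddCommGroup X] [Module ℝ X] {n : ℕ} (α : ℝ)
    (f : (Fin n → Bool) → X) (x : Fin n → Bool) :
    resampleOp α 0 f x = ∑ y : Fin n → Bool, biasedWeight (fun _ : Fin n => α) y • f y := by
  simp [resampleOp, resample, biasedWeight, coinWeight]

theorem hasDerivAt_resampleOp_aux {X : Type*} [NormedAddCommGroup X] [NormedSpace ℝ X] {n : ℕ}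
    (α s : ℝ) (f : (Fin n → Bool) → X) (x : Fin n → Bool) :
    HasDerivAt (fun s => resampleOp α s f x)
      (∑ y : Fin n → Bool, (∑ i, (∏ j ∈ univ.erase i, resample α s (x j) (y j)) *
        ((if x i = y i then 1 else 0) - coinWeight α (y i))) • f y) s := by
  refine HasDerivAt.fun_sum fun y _ => HasDerivAt.smul_const ?_ (f y)
  refine HasDerivAt.fun_finsetProd fun i _ => ?_
  have := ((hasDerivAt_id s).mul_const (if x i = y i then (1 : ℝ) else 0)).add
    (((hasDerivAt_id s).const_sub 1).mul_const (coinWeight α (y i)))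
  convert! this using 1
  ring

/-- A function which does not depend on the `i`-th coordinate is annihilated by the derivative of
the kernel in that coordinate. -/
theorem sum_prod_erase_smul_eq_zero {X : Type*} [AddCommGroup X] [Module ℝ X] {n : ℕ}
    (α s : ℝ) (x : Fin n → Bool) (i : Fin n) (g : (Fin n → Bool) → X)
    (hg : ∀ y b, g (Function.update y i b) = g y) :
    ∑ y : Fin n → Bool, ((∏ j ∈ univ.erase i, resample α s (x j) (y j)) *
        ((if x i = y i then 1 else 0) - coinWeight α (y i))) • g y = 0 := by
  have : IsAddTorsionFree X := .of_isTorsionFree ℝ X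
  refine self_eq_neg.1 ?_
  have hinv : Function.Involutive fun y : Fin n → Bool => flipc y i := by
    intro y
    simp [flipc]
  conv_lhs => rw [← hinv.bijective.sum_comp]
  rw [← Finset.sum_neg_distrib]
  refine Finset.sum_congr rfl fun y _ => ?_
  have hgf : g (flipc y i) = g y := hg y _
  have hfi : flipc y i i = !y i := by simp [flipc]
  rw [← neg_smul, hgf, ← mul_neg]
  congr 2
  · refine Finset.prod_congr rfl fun j hj => ?_
    rw [flipc, Function.update_of_ne (Finset.ne_of_mem_erase hj)]
  · simp only [hfi]
    cases x i <;> cases y i <;> simp [coinWeight]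

theorem hasDerivAt_resampleOp {X : Type*} [NormedAddCommGroup X] [NormedSpace ℝ X] {n : ℕ}
    {α s : ℝ} (h0 : 0 < α) (h1 : α < 1) (hs0 : 0 ≤ s) (hs1 : s < 1)
    (f : (Fin n → Bool) → X) (x : Fin n → Bool) :
    HasDerivAt (fun s => resampleOp α s f x)
      (∑ y : Fin n → Bool, (∏ i, resample α s (x i) (y i)) •
        ∑ i, noiseCoeff α s (x i) (y i) • bder α i f y) s := by
  convert! hasDerivAt_resampleOp_aux α s f x using 1
  simp only [Finset.smul_sum, Finset.sum_smul]
  rw [Finset.sum_comm, Finset.sum_comm (s := univ (α := Fin n → Bool))]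
  refine Finset.sum_congr rfl fun i _ => ?_
  rw [← sub_eq_zero, ← Finset.sum_sub_distrib, ← neg_eq_zero, ← Finset.sum_neg_distrib]
  rw [← sum_prod_erase_smul_eq_zero α s x i
    (fun y => α • f (Function.update y i true) + (1 - α) • f (Function.update y i false))
    (fun y b => by simp)]
  refine Finset.sum_congr rfl fun y _ => ?_
  have hne := (resample_pos h0 h1 hs0 hs1 (x i) (y i)).ne'
  have e : (∏ j, resample α s (x j) (y j)) * noiseCoeff α s (x i) (y i) =
      (∏ j ∈ univ.erase i, resample α s (x j) (y j)) *
        ((if x i = y i then 1 else 0) - coinWeight α (y i)) := by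
    rw [← Finset.prod_erase_mul _ _ (Finset.mem_univ i), mul_assoc, noiseCoeff,
      mul_div_cancel₀ _ hne]
  rw [smul_smul, e, bder, ← smul_sub, ← smul_neg]
  congr 1
  abel

theorem norm_sum_smul_rpow_le_s13 {ι X : Type*} [NormedAddCommGroup X] [NormedSpace ℝ X]
    (s : Finset ι) {w : ι → ℝ} (hw : ∀ i ∈ s, 0 ≤ w i) (hw1 : ∑ i ∈ s, w i = 1) (g : ι → X)
    {p : ℝ} (hp : 1 ≤ p) :
    ‖∑ i ∈ s, w i • g i‖ ^ p ≤ ∑ i ∈ s, w i * ‖g i‖ ^ p := by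
  refine le_trans ?_ (Real.rpow_arith_mean_le_arith_mean_rpow s w (fun i => ‖g i‖) hw hw1
    (fun _ _ => norm_nonneg _) hp)
  refine Real.rpow_le_rpow (norm_nonneg _) ((norm_sum_le _ _).trans_eq ?_) (by linarith)
  exact Finset.sum_congr rfl fun i hi => norm_smul_of_nonneg (hw i hi) _

theorem biasedWeight_nonneg_s13 {α : ℝ} (h0 : 0 < α) (h1 : α < 1) {n : ℕ} (x : Fin n → Bool) :
    0 ≤ biasedWeight (fun _ : Fin n => α) x :=
  Finset.prod_nonneg fun i _ => (coinWeight_pos h0 h1 (x i)).le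

theorem lpNormW_rpow {ι X : Type*} [Fintype ι] [DecidableEq ι] [NormedAddCommGroup X]
    {μ : (ι → Bool) → ℝ} (hμ : ∀ x, 0 ≤ μ x) {p : ℝ} (hp : p ≠ 0) (g : (ι → Bool) → X) :
    lpNormW μ p g ^ p = ∑ x, μ x * ‖g x‖ ^ p := by
  rw [lpNormW, ← Real.rpow_mul, one_div_mul_cancel hp, Real.rpow_one]
  exact Finset.sum_nonneg fun x _ => mul_nonneg (hμ x) (by positivity)

/-- If, conditionally on the second variable, the noise moments are dominated by Rademacher
moments, then the derivative of the resampling semigroup is bounded in `L_p`. -/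
theorem lpNormW_sum_prod_resample_le {X : Type*} [NormedAddCommGroup X] [NormedSpace ℝ X] {n : ℕ}
    {α s p D : ℝ} (h0 : 0 < α) (h1 : α < 1) (hs0 : 0 ≤ s) (hs1 : s < 1) (hp : 1 ≤ p) (hD : 0 ≤ D)
    (H : ∀ (y : Fin n → Bool) (v : Fin n → X),
      ∑ x : Fin n → Bool, (∏ i, resample α s (y i) (x i)) *
        ‖∑ i, noiseCoeff α s (x i) (y i) • v i‖ ^ p ≤
      D ^ p * ((2 ^ n : ℝ)⁻¹ * ∑ δ : Fin n → Bool, ‖∑ i, sgn (δ i) • v i‖ ^ p))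
    (f : (Fin n → Bool) → X) :
    lpNormW (biasedWeight fun _ : Fin n => α) p
        (fun x => ∑ y : Fin n → Bool, (∏ i, resample α s (x i) (y i)) •
          ∑ i, noiseCoeff α s (x i) (y i) • bder α i f y) ≤
      D * ((2 ^ n : ℝ)⁻¹ * ∑ δ : Fin n → Bool,
        lpNormW (biasedWeight fun _ : Fin n => α) p
          (fun x => ∑ i, sgn (δ i) • bder α i f x) ^ p) ^ (1 / p) := by
  have hp0 : p ≠ 0 := by linarith
  have hμ := biasedWeight_nonneg_s13 h0 h1 (n := n)
  have hR : ∀ x y : Fin n → Bool, 0 ≤ ∏ i, resample α s (x i) (y i) := fun x y =>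
    Finset.prod_nonneg fun i _ => (resample_pos h0 h1 hs0 hs1 _ _).le
  have hrev : ∀ x y : Fin n → Bool,
      biasedWeight (fun _ : Fin n => α) x * ∏ i, resample α s (x i) (y i) =
        biasedWeight (fun _ : Fin n => α) y * ∏ i, resample α s (y i) (x i) := by
    intro x y
    unfold biasedWeight
    rw [← Finset.prod_mul_distrib, ← Finset.prod_mul_distrib]
    exact Finset.prod_congr rfl fun i _ => coinWeight_mul_resample α s (x i) (y i)
  simp only [lpNormW_rpow hμ hp0]
  set S := (2 ^ n : ℝ)⁻¹ * ∑ δ : Fin n → Bool, ∑ x, biasedWeight (fun _ : Fin n => α) x *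
    ‖∑ i, sgn (δ i) • bder α i f x‖ ^ p with hS
  have hS0 : 0 ≤ S := mul_nonneg (by positivity) (Finset.sum_nonneg fun δ _ =>
    Finset.sum_nonneg fun x _ => mul_nonneg (hμ x) (by positivity))
  have hDS : D * S ^ (1 / p) = (D ^ p * S) ^ (1 / p) := by
    rw [Real.mul_rpow (by positivity) hS0, ← Real.rpow_mul hD, mul_one_div_cancel hp0,
      Real.rpow_one]
  rw [hDS, lpNormW]
  refine Real.rpow_le_rpow (Finset.sum_nonneg fun x _ => mul_nonneg (hμ x) (by positivity)) ?_
    (by positivity)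
  calc _ ≤ ∑ x, biasedWeight (fun _ : Fin n => α) x * ∑ y : Fin n → Bool,
          (∏ i, resample α s (x i) (y i)) *
            ‖∑ i, noiseCoeff α s (x i) (y i) • bder α i f y‖ ^ p := by
        gcongr with x
        · exact hμ x
        · exact norm_sum_smul_rpow_le_s13 _ (fun y _ => hR x y) (sum_prod_resample α s x) _ hp
    _ = ∑ y, biasedWeight (fun _ : Fin n => α) y * ∑ x : Fin n → Bool,
          (∏ i, resample α s (y i) (x i)) *
            ‖∑ i, noiseCoeff α s (x i) (y i) • bder α i f y‖ ^ p := by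
        simp only [Finset.mul_sum, ← mul_assoc]
        rw [Finset.sum_comm]
        refine Finset.sum_congr rfl fun y _ => Finset.sum_congr rfl fun x _ => ?_
        rw [hrev]
    _ ≤ ∑ y, biasedWeight (fun _ : Fin n => α) y * (D ^ p * ((2 ^ n : ℝ)⁻¹ *
          ∑ δ : Fin n → Bool, ‖∑ i, sgn (δ i) • bder α i f y‖ ^ p)) := by
        gcongr with y
        · exact hμ y
        · exact H y _
    _ = D ^ p * S := by
        rw [hS, Finset.sum_comm]
        simp only [Finset.mul_sum]
        refine Finset.sum_congr rfl fun y _ => Finset.sum_congr rfl fun δ _ => ?_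
        ring

/-- Integrating the bound on the derivative of the resampling semigroup. -/
theorem lpNormW_sub_le_of_deriv_le {X : Type*} [NormedAddCommGroup X] [NormedSpace ℝ X] {n : ℕ}
    {α p R A : ℝ} (h0 : 0 < α) (h1 : α < 1) (hp : 1 ≤ p) (hR : 0 < R)
    (f : (Fin n → Bool) → X)
    (H : ∀ s : ℝ, 0 ≤ s → s < 1 → lpNormW (biasedWeight fun _ : Fin n => α) p
        (fun x => ∑ y : Fin n → Bool, (∏ i, resample α s (x i) (y i)) •
          ∑ i, noiseCoeff α s (x i) (y i) • bder α i f y) ≤ A * (1 - s) ^ (1 / R - 1)) :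
    lpNormW (biasedWeight fun _ : Fin n => α) p
      (fun x => f x - ∑ y : Fin n → Bool, biasedWeight (fun _ : Fin n => α) y • f y) ≤ A * R := by
  have hp0 : 0 < p := by linarith
  have hμ := biasedWeight_nonneg_s13 h0 h1 (n := n)
  set P := ENNReal.ofReal p with hP
  have hPp : P.toReal = p := ENNReal.toReal_ofReal hp0.le
  have : Fact (1 ≤ P) := ⟨by simpa [hP] using hp⟩
  set w : (Fin n → Bool) → ℝ := fun x => biasedWeight (fun _ : Fin n => α) x ^ (1 / p) with hw
  have hnorm : ∀ g : (Fin n → Bool) → X,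
      ‖(WithLp.toLp P fun x => w x • g x : PiLp P fun _ : Fin n → Bool => X)‖ =
        lpNormW (biasedWeight fun _ : Fin n => α) p g := by
    intro g
    rw [PiLp.norm_eq_sum (by rw [hPp]; exact hp0), hPp, lpNormW]
    congr 1
    refine Finset.sum_congr rfl fun x _ => ?_
    have hwx : 0 ≤ w x := Real.rpow_nonneg (hμ x) _
    simp only [norm_smul_of_nonneg hwx]
    rw [Real.mul_rpow hwx (norm_nonneg _), hw, ← Real.rpow_mul (hμ x),
      one_div_mul_cancel hp0.ne', Real.rpow_one]
  have hderiv : ∀ {s : ℝ} {g : ℝ → (Fin n → Bool) → X} {g' : (Fin n → Bool) → X},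
      (∀ x, HasDerivAt (fun s => g s x) (g' x) s) →
      HasDerivAt (fun s => (WithLp.toLp P fun x => w x • g s x : PiLp P fun _ => X))
        (WithLp.toLp P fun x => w x • g' x) s := by
    intro s g g' h
    exact (PiLp.hasFDerivAt_toLp P (𝕜 := ℝ) _).comp_hasDerivAt s
      (hasDerivAt_pi.2 fun x => (h x).const_smul (w x))
  have hmain := image_norm_le_of_norm_deriv_right_le_deriv_boundary' (a := 0) (b := 1)
    (f := fun s => (WithLp.toLp P fun x => w x • (resampleOp α s f x - resampleOp α 0 f x) :
      PiLp P fun _ => X))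
    (f' := fun s => WithLp.toLp P fun x => w x • ∑ y : Fin n → Bool,
      (∏ i, resample α s (x i) (y i)) • ∑ i, noiseCoeff α s (x i) (y i) • bder α i f y)
    (B := fun s => A * R * (1 - (1 - s) ^ (1 / R))) (B' := fun s => A * (1 - s) ^ (1 / R - 1))
    (fun s _ => (hderiv fun x =>
      (hasDerivAt_resampleOp_aux α s f x).sub_const _).continuousAt.continuousWithinAt)
    (fun s hs => (hderiv fun x =>
      (hasDerivAt_resampleOp h0 h1 hs.1 hs.2 f x).sub_const _).hasDerivWithinAt)
    (by simp [← Pi.zero_def])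
    (by
      refine ContinuousOn.mul continuousOn_const (continuousOn_const.sub ?_)
      exact (continuousOn_const.sub continuousOn_id).rpow_const fun _ _ => Or.inr (by positivity))
    (fun s hs => by
      have := ((((hasDerivAt_id s).const_sub 1).rpow_const (p := 1 / R)
        (Or.inl (sub_pos.2 hs.2).ne')).const_sub 1).const_mul (A * R)
      convert! this.hasDerivWithinAt using 1
      simp only [id]
      field_simp)
    (fun s hs => by
      rw [hnorm]
      exact H s hs.1 hs.2) (Set.right_mem_Icc.2 zero_le_one)
  rw [hnorm] at hmain
  simpa [resampleOp_one, resampleOp_zero, hR.ne'] using hmain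

/-- The biased Pisier inequality with a dimension-free constant for
normed spaces of cotype `q` with constant `Cq`. -/
theorem stmt13 (p α q Cq : ℝ) (hp : 1 ≤ p) (hα0 : 0 < α) (hα1 : α < 1)
    (hq : 2 ≤ q) (hCq : 0 < Cq) :
    ∃ K : ℝ, 0 < K ∧
      ∀ (X : Type) [NormedAddCommGroup X] [NormedSpace ℝ X],
      CotypeC X q Cq →
      ∀ (n : ℕ) (f : (Fin n → Bool) → X),
      lpNormW (biasedWeight fun _ : Fin n => α) p
          (fun x => f x - ∑ y : Fin n → Bool, biasedWeight (fun _ : Fin n => α) y • f y) ≤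
        K * ((2 ^ n : ℝ)⁻¹ * ∑ δ : Fin n → Bool,
            lpNormW (biasedWeight fun _ : Fin n => α) p
              (fun x => ∑ i, sgn (δ i) • bder α i f x) ^ p) ^ (1 / p) := by
  obtain ⟨k, hk⟩ := exists_nat_ge (max p q + 1)
  have hk1 : (1 : ℝ) ≤ k := by linarith [le_max_left p q]
  have hk0 : k ≠ 0 := by
    rintro rfl
    norm_num at hk1
  have hpk : p ≤ (2 * k : ℕ) := by push_cast; linarith [le_max_left p q]
  have hqk : q ≤ (2 * k : ℕ) := by push_cast; linarith [le_max_right p q]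
  obtain ⟨K, hK, hkah⟩ := exists_kahane_const k hk0
  have hβ := mul_pos hα0 (sub_pos.2 hα1)
  set κ := 4 / (α * (1 - α)) with hκdef
  have hκ : 4 ≤ κ := by
    rw [hκdef, le_div_iff₀ hβ]
    nlinarith
  have hκα : ∀ b, 1 ≤ κ * coinWeight α b := by
    intro b
    rw [hκdef, div_mul_eq_mul_div, le_div_iff₀ hβ]
    cases b <;> simp only [coinWeight, if_true, Bool.false_eq_true, if_false] <;> nlinarith
  have hkR : (0 : ℝ) < (2 * k : ℕ) := by push_cast; linarith
  refine ⟨κ * Cq * K * (2 * k : ℕ), by positivity, fun X _ _ hX n f => ?_⟩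
  rw [mul_right_comm]
  refine lpNormW_sub_le_of_deriv_le hα0 hα1 hp hkR f fun s hs0 hs1 => ?_
  rw [mul_right_comm]
  refine lpNormW_sum_prod_resample_le hα0 hα1 hs0 hs1 hp
    (mul_nonneg (by positivity) (Real.rpow_nonneg (sub_pos.2 hs1).le _)) (fun y v => ?_) f
  exact sum_prod_resample_mul_norm_rpow_le hk0 hCq hK hp hpk
    (fun m v => hX.sum_norm_pow_le (by linarith) hCq hqk v) (hkah X p hp)
    hα0 hα1 hs0 hs1 hκ hκα y v
end
end
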